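/- arXiv:1808.01579 — 2 statements merged into one kernel-verified Lean document; each statement's English description precedes it below -/
import Mathlib

section
/- Let F be a field and M ∈ GL_n(F) with det M = 1 or det M = −1. Assume that for each eigenvalue λ ∈ F of M, the matrix M has at most one Jordan cell of size 1 for λ (equivalently, dim ker(M − λI_n) − dim(ker(M − λI_n) ∩ im(M − λI_n)) ≤ 1), and that the characteristic polynomial of M is not a power of an irreducible polynomial. Then for every k ∈ {0, 1, 2}, the matrix M is the product of k U2-matrices and 3 − k involutions of GL_n(F). Moreover, if det M = 1 then M is the product of three U2-matrices. -/
section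

open Polynomial Module

/-- `v` is a cyclic vector of `N`. -/
def IsCyclicVector {F V : Type*} [Field F] [AddCommGroup V] [Module F V]
    (N : End F V) (v : V) : Prop :=
  ∀ Z : Submodule F V, v ∈ Z → (∀ x ∈ Z, N x ∈ Z) → Z = ⊤

section Cyclic

variable {F V : Type*} [Field F] [AddCommGroup V] [Module F V]

theorem pow_natDegree_apply_mem_of_aeval_apply_eq_zero {N : End F V} {v : V} {p : F[X]}
    (hp : p.Monic) (hv : aeval N p v = 0) {Z : Submodule F V}
    (hZ : ∀ k < p.natDegree, (N ^ k) v ∈ Z) : (N ^ p.natDegree) v ∈ Z := by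
  have h := hv
  rw [hp.as_sum, map_add, LinearMap.add_apply, map_pow, aeval_X] at h
  rw [eq_neg_of_add_eq_zero_left h, map_sum, LinearMap.sum_apply]
  refine Z.neg_mem (Z.sum_mem fun k hk => ?_)
  rw [map_mul, aeval_C, map_pow, aeval_X, Module.End.mul_apply, Module.algebraMap_end_apply]
  exact Z.smul_mem _ (hZ k (Finset.mem_range.1 hk))

theorem IsCyclicVector.span_pow_eq_top {N : End F V} {v : V} (h : IsCyclicVector N v) {p : F[X]}
    (hp : p.Monic) (hv : aeval N p v = 0) :
    Submodule.span F (Set.range fun k : Fin p.natDegree => (N ^ (k : ℕ)) v) = ⊤ := by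
  set Z := Submodule.span F (Set.range fun k : Fin p.natDegree => (N ^ (k : ℕ)) v) with hZ
  have h1 : ∀ k < p.natDegree, (N ^ k) v ∈ Z := fun k hk =>
    Submodule.subset_span ⟨⟨k, hk⟩, rfl⟩
  have h2 := pow_natDegree_apply_mem_of_aeval_apply_eq_zero hp hv h1
  have h3 : ∀ k ≤ p.natDegree, (N ^ k) v ∈ Z := fun k hk => by
    rcases hk.lt_or_eq with hk | rfl
    exacts [h1 k hk, h2]
  refine h Z (by simpa using h3 0 (Nat.zero_le _)) fun x hx => ?_
  have : Z ≤ Z.comap N := by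
    rw [hZ, Submodule.span_le, ← hZ]
    rintro _ ⟨k, rfl⟩
    have := h3 (k + 1) k.2
    rwa [pow_succ', Module.End.mul_apply] at this
  exact this hx

theorem IsCyclicVector.apply_self [FiniteDimensional F V] {N : End F V} {v : V}
    (h : IsCyclicVector N v) (hN : Function.Injective N) : IsCyclicVector N (N v) := by
  intro Z hv hZ
  have h1 : Z.comap N = ⊤ := h _ hv fun x hx => hZ _ hx
  refine eq_top_iff.2 fun x _ => ?_
  obtain ⟨y, rfl⟩ := LinearMap.injective_iff_surjective.1 hN x
  change y ∈ Z.comap N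
  rw [h1]
  exact Submodule.mem_top

/-- Two endomorphisms with cyclic vectors annihilated by the same monic polynomial are similar. -/
theorem exists_linearEquiv_of_isCyclicVector {V' : Type*} [AddCommGroup V'] [Module F V']
    {N : End F V} {v : V} {T : End F V'} {v' : V'} (h : IsCyclicVector N v)
    (h' : IsCyclicVector T v') {p : F[X]} (hp : p.Monic) (hv : aeval N p v = 0)
    (hv' : aeval T p v' = 0) (hd : finrank F V = p.natDegree) (hd' : finrank F V' = p.natDegree) :
    ∃ e : V ≃ₗ[F] V', ∀ x, e (N x) = T (e x) := by
  set b := basisOfTopLeSpanOfCardEqFinrank _ (h.span_pow_eq_top hp hv).ge (by simp [hd])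
  set b' := basisOfTopLeSpanOfCardEqFinrank _ (h'.span_pow_eq_top hp hv').ge (by simp [hd'])
  have hb : ∀ k, b k = (N ^ (k : ℕ)) v := fun k => by simp [b]
  have hb' : ∀ k, b' k = (T ^ (k : ℕ)) v' := fun k => by simp [b']
  set e := b.equiv b' (Equiv.refl _)
  have h1 : ∀ k < p.natDegree, e ((N ^ k) v) = (T ^ k) v' := fun k hk => by
    rw [← hb ⟨k, hk⟩, Basis.equiv_apply, Equiv.refl_apply, hb']
  have h2 : e ((N ^ p.natDegree) v) = (T ^ p.natDegree) v' := by
    rw [hp.as_sum, map_add, LinearMap.add_apply, map_pow, aeval_X] at hv hv'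
    rw [eq_neg_of_add_eq_zero_left hv, eq_neg_of_add_eq_zero_left hv', map_neg, map_sum, map_sum,
      LinearMap.sum_apply, LinearMap.sum_apply, map_sum]
    congr 1
    refine Finset.sum_congr rfl fun k hk => ?_
    simp only [map_mul, aeval_C, map_pow, aeval_X, Module.End.mul_apply,
      Module.algebraMap_end_apply, map_smul]
    rw [h1 k (Finset.mem_range.1 hk)]
  have h3 : ∀ k ≤ p.natDegree, e ((N ^ k) v) = (T ^ k) v' := fun k hk => by
    rcases hk.lt_or_eq with hk | rfl
    exacts [h1 k hk, h2]
  refine ⟨e, fun x => ?_⟩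
  have : e.toLinearMap ∘ₗ N = T ∘ₗ e.toLinearMap := by
    refine b.ext fun k => ?_
    have h4 := h3 (k + 1) k.2
    rw [pow_succ', pow_succ', Module.End.mul_apply, Module.End.mul_apply] at h4
    simp only [LinearMap.comp_apply, LinearEquiv.coe_coe, hb]
    rw [h4, h1 k k.2]
  exact LinearMap.congr_fun this x

/-- Some vector has the minimal polynomial of the endomorphism as its annihilator. -/
theorem exists_minpoly_dvd_of_aeval_apply_eq_zero [FiniteDimensional F V] (M : End F V) :
    ∃ x : V, ∀ g : F[X], aeval M g x = 0 → minpoly F M ∣ g := by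
  obtain ⟨x, hx⟩ := exists_ker_toSpanSingleton_eq_annihilator F[X] (AEval' M)
  obtain ⟨x, rfl⟩ := (AEval'.of M).surjective x
  refine ⟨x, fun g hg => ?_⟩
  rw [← span_minpoly_eq_annihilator] at hx
  rw [← Ideal.mem_span_singleton, ← hx, LinearMap.mem_ker, LinearMap.toSpanSingleton_apply]
  have := AEval.of_aeval_smul (R := F) (a := M) g x
  rw [Module.End.smul_def, hg, map_zero] at this
  exact this.symm

end Cyclic

/-- `M` has at most one Jordan cell of size `1` for each eigenvalue in the base field. -/
def HasFewSimpleCells {F V : Type*} [Field F] [AddCommGroup V] [Module F V] (M : End F V) : Prop :=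
  ∀ (c : F) (x y : V), M x = c • x → M y = c • y →
    ∃ s t : F, (s ≠ 0 ∨ t ≠ 0) ∧ ∃ v, s • x + t • y = M v - c • v

section Quadratic

variable {F : Type*} [Field F]

theorem injective_of_quadratic {V : Type*} [AddCommGroup V] [Module F V] {S : End F V} {a b : F}
    (ha : a ≠ 0) (hb : b ≠ 0) (hS : ∀ v, S (S v) = (a + b) • S v - (a * b) • v) :
    Function.Injective S := by
  refine (injective_iff_map_eq_zero S).2 fun v hv => ?_
  have := hS v
  rw [hv, map_zero, smul_zero, zero_sub, eq_comm, neg_eq_zero] at this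
  exact (smul_eq_zero.1 this).resolve_left (mul_ne_zero ha hb)

/-- A vector `x` whose annihilator is generated by the minimal polynomial has a linear form
dual to the last iterate. -/
theorem exists_dual_apply_pow_eq {V : Type*} [AddCommGroup V] [Module F V] {M : End F V} {x : V}
    {d : ℕ} (hx : ∀ g : F[X], g.degree < d → aeval M g x = 0 → g = 0) :
    ∃ f : Dual F V, ∀ k < d, f ((M ^ k) x) = if k + 1 = d then 1 else 0 := by
  have hli : LinearIndependent F fun k : Fin d => (M ^ (k : ℕ)) x := by
    rw [Fintype.linearIndependent_iff]
    intro g hg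
    have h1 : (∑ i : Fin d, monomial (i : ℕ) (g i)) = 0 := by
      refine hx _ ?_ ?_
      · refine (degree_sum_le _ _).trans_lt ?_
        refine (Finset.sup_lt_iff (WithBot.bot_lt_coe _)).2 fun i _ => ?_
        exact (degree_monomial_le _ _).trans_lt (by exact_mod_cast i.2)
      · simpa [map_sum, aeval_monomial] using hg
    intro i
    have h2 := congrArg (fun q : F[X] => q.coeff i) h1
    simpa [finsetSum_coeff, coeff_monomial, Fin.val_inj] using h2
  obtain ⟨f, hf⟩ := (Basis.span hli).constr F
    (fun k : Fin d => if (k : ℕ) + 1 = d then (1 : F) else 0) |>.exists_extend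
  refine ⟨f, fun k hk => ?_⟩
  have h1 := LinearMap.congr_fun hf (Basis.span hli ⟨k, hk⟩)
  rw [Basis.constr_basis, LinearMap.comp_apply, Submodule.subtype_apply, Basis.span_apply] at h1
  exact h1

/-- The submodule of vectors orthogonal to the orbit of a linear form. -/
def orbitOrthogonal {V : Type*} [AddCommGroup V] [Module F V] (M : End F V) (f : Dual F V) :
    Submodule F V :=
  ⨅ k : ℕ, LinearMap.ker (f ∘ₗ (M ^ k))

theorem mem_orbitOrthogonal {V : Type*} [AddCommGroup V] [Module F V] {M : End F V}
    {f : Dual F V} {v : V} : v ∈ orbitOrthogonal M f ↔ ∀ k, f ((M ^ k) v) = 0 := by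
  simp [orbitOrthogonal]

theorem apply_mem_orbitOrthogonal {V : Type*} [AddCommGroup V] [Module F V] {M : End F V}
    {f : Dual F V} {v : V} (hv : v ∈ orbitOrthogonal M f) : M v ∈ orbitOrthogonal M f := by
  rw [mem_orbitOrthogonal] at hv ⊢
  intro k
  simpa [pow_succ] using hv (k + 1)

theorem apply_aeval_eq_coeff {V : Type*} [AddCommGroup V] [Module F V] {M : End F V} {x : V}
    {f : Dual F V} {d : ℕ} (hf : ∀ k < d, f ((M ^ k) x) = if k + 1 = d then 1 else 0) {g : F[X]}
    (hg : g.degree < d) : f (aeval M g x) = if d = 0 then 0 else g.coeff (d - 1) := by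
  rcases eq_or_ne d 0 with rfl | hd
  · have : g = 0 := by simpa using hg
    simp [this]
  · have hg' : g.natDegree < d := by
      rcases eq_or_ne g 0 with rfl | h0
      · simpa using Nat.pos_of_ne_zero hd
      · exact (natDegree_lt_iff_degree_lt h0).2 hg
    rw [aeval_eq_sum_range' hg', LinearMap.sum_apply, map_sum, if_neg hd]
    rw [Finset.sum_eq_single (d - 1)]
    · rw [LinearMap.smul_apply, map_smul, hf _ (by omega), if_pos (by omega), smul_eq_mul, mul_one]
    · intro k hk hk'
      rw [Finset.mem_range] at hk
      rw [LinearMap.smul_apply, map_smul, hf _ hk, if_neg (by omega), smul_zero]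
    · intro h
      exact absurd (Finset.mem_range.2 (by omega)) h

/-- If `f` is dual to the last iterate of `x`, no nonzero polynomial of small degree sends `x`
into the orthogonal of the orbit of `f`. -/
theorem eq_zero_of_aeval_apply_mem_orbitOrthogonal {V : Type*} [AddCommGroup V] [Module F V]
    {M : End F V} {x : V} {f : Dual F V} {d : ℕ}
    (hf : ∀ k < d, f ((M ^ k) x) = if k + 1 = d then 1 else 0) {g : F[X]}
    (hg : g.degree < d) (h : aeval M g x ∈ orbitOrthogonal M f) : g = 0 := by
  by_contra h0
  have hg' := (natDegree_lt_iff_degree_lt h0).2 hg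
  have h1 := mem_orbitOrthogonal.1 h (d - 1 - g.natDegree)
  have h2 : (M ^ (d - 1 - g.natDegree)) (aeval M g x)
      = aeval M (X ^ (d - 1 - g.natDegree) * g) x := by simp
  rw [h2, apply_aeval_eq_coeff hf, if_neg (by omega)] at h1
  · have h3 := coeff_X_pow_mul g (d - 1 - g.natDegree) g.natDegree
    rw [show g.natDegree + (d - 1 - g.natDegree) = d - 1 by omega, h1] at h3
    exact h0 (leadingCoeff_eq_zero.1 h3.symm)
  · rw [degree_mul, degree_X_pow, degree_eq_natDegree h0]
    exact_mod_cast (by omega)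

theorem mem_orbitOrthogonal_of_lt {V : Type*} [AddCommGroup V] [Module F V] {M : End F V}
    {f : Dual F V} {v : V} {p : F[X]} (hp : p.Monic) (hM : aeval M p = 0)
    (hv : ∀ k < p.natDegree, f ((M ^ k) v) = 0) : v ∈ orbitOrthogonal M f := by
  rw [mem_orbitOrthogonal]
  intro k
  rcases eq_or_ne p 1 with rfl | h1
  · rw [map_one] at hM
    have : (M ^ k) v = 0 := by
      rw [← Module.End.one_apply (R := F) ((M ^ k) v), hM, LinearMap.zero_apply]
    rw [this, map_zero]
  · have h2 : M ^ k = aeval M (X ^ k %ₘ p) := by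
      rw [aeval_modByMonic_eq_self_of_root hM, map_pow, aeval_X]
    rw [h2, aeval_eq_sum_range' (natDegree_modByMonic_lt _ hp h1), LinearMap.sum_apply, map_sum]
    refine Finset.sum_eq_zero fun i hi => ?_
    rw [LinearMap.smul_apply, map_smul, hv i (Finset.mem_range.1 hi), smul_zero]

theorem exists_sub_aeval_mem_orbitOrthogonal {V : Type*} [AddCommGroup V] [Module F V]
    {M : End F V} {x : V} {f : Dual F V} {p : F[X]} (hp : p.Monic) (hM : aeval M p = 0)
    (hf : ∀ k < p.natDegree, f ((M ^ k) x) = if k + 1 = p.natDegree then 1 else 0) (v : V) :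
    ∃ g : F[X], v - aeval M g x ∈ orbitOrthogonal M f := by
  let L : (Fin p.natDegree → F) →ₗ[F] F[X] :=
    ∑ i : Fin p.natDegree, monomial (i : ℕ) ∘ₗ LinearMap.proj i
  have hL : ∀ c, (L c).degree < p.natDegree := fun c => by
    simp only [L, LinearMap.sum_apply, LinearMap.comp_apply, LinearMap.proj_apply]
    refine (degree_sum_le _ _).trans_lt ?_
    refine (Finset.sup_lt_iff (WithBot.bot_lt_coe _)).2 fun i _ => ?_
    exact (degree_monomial_le _ _).trans_lt (by exact_mod_cast i.2)
  have hL0 : ∀ c, L c = 0 → c = 0 := fun c hc => by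
    funext i
    have h2 := congrArg (fun q : F[X] => q.coeff i) hc
    simpa [L, finsetSum_coeff, coeff_monomial, Fin.val_inj] using h2
  let P : V →ₗ[F] (Fin p.natDegree → F) :=
    LinearMap.pi fun k : Fin p.natDegree => f ∘ₗ (M ^ (k : ℕ))
  let E : F[X] →ₗ[F] V := (LinearMap.applyₗ x) ∘ₗ (aeval M).toLinearMap
  have hE : ∀ g, E g = aeval M g x := fun g => rfl
  have hP : ∀ w, P w = 0 → w ∈ orbitOrthogonal M f := fun w hw =>
    mem_orbitOrthogonal_of_lt hp hM fun k hk => congrFun hw ⟨k, hk⟩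
  have hinj : Function.Injective (P ∘ₗ E ∘ₗ L) := by
    refine (injective_iff_map_eq_zero _).2 fun c hc => hL0 c ?_
    exact eq_zero_of_aeval_apply_mem_orbitOrthogonal hf (hL c) (hP _ hc)
  obtain ⟨c, hc⟩ := LinearMap.injective_iff_surjective.1 hinj (P v)
  refine ⟨L c, hP _ ?_⟩
  rw [map_sub, ← hc, ← hE, LinearMap.comp_apply, LinearMap.comp_apply, sub_self]

/-- An invertible endomorphism with few simple cells becomes cyclic after right multiplication by
a suitable quadratic endomorphism `S` with `(S - a)(S - b) = 0`, with a cyclic vector in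
the eigenspace of `S` for `a`. -/
theorem exists_quadratic_isCyclicVector {a b : F} (ha : a ≠ 0) (hb : b ≠ 0) (n : ℕ) :
    ∀ {V : Type*} [AddCommGroup V] [Module F V] [FiniteDimensional F V] (M : End F V),
      finrank F V = n → Nontrivial V → Function.Injective M → HasFewSimpleCells M →
      ∃ (S : End F V) (e : V), (∀ v, S (S v) = (a + b) • S v - (a * b) • v) ∧ S e = a • e ∧
        IsCyclicVector (M * S) e := by
  induction n using Nat.strong_induction_on with
  | _ n ih =>
  intro V _ _ _ M hn hnt hinj hM
  obtain ⟨x, hx⟩ := exists_minpoly_dvd_of_aeval_apply_eq_zero M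
  have hpm : (minpoly F M).Monic := minpoly.monic (Algebra.IsIntegral.isIntegral M)
  have hpM : aeval M (minpoly F M) = 0 := minpoly.aeval F M
  have hd : 0 < (minpoly F M).natDegree := minpoly.natDegree_pos (Algebra.IsIntegral.isIntegral M)
  generalize hp : minpoly F M = p at *
  obtain ⟨f, hf⟩ := exists_dual_apply_pow_eq (M := M) (x := x) (d := p.natDegree) (by
    intro g hg hgx
    by_contra h0
    refine absurd (degree_le_of_dvd (hx g hgx) h0) ?_
    rwa [not_le, degree_eq_natDegree hpm.ne_zero])
  set W := orbitOrthogonal M f with hW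
  have hWM : ∀ w ∈ W, M w ∈ W := fun w hw => apply_mem_orbitOrthogonal hw
  set V₁ : Submodule F V := LinearMap.range ((LinearMap.applyₗ x) ∘ₗ (aeval M).toLinearMap)
    with hV₁
  have hV₁g : ∀ g : F[X], aeval M g x ∈ V₁ := fun g => ⟨g, rfl⟩
  have hV₁M : ∀ v ∈ V₁, M v ∈ V₁ := by
    rintro _ ⟨g, rfl⟩
    exact ⟨X * g, by simp⟩
  have hxV₁ : x ∈ V₁ := by simpa using hV₁g 1
  have hc : IsCompl V₁ W := by
    constructor
    · rw [Submodule.disjoint_def]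
      rintro _ ⟨g, rfl⟩ hg
      have h1 : aeval M g = aeval M (g %ₘ p) := (aeval_modByMonic_eq_self_of_root hpM).symm
      change aeval M g x ∈ W at hg
      change aeval M g x = 0
      rw [h1] at hg ⊢
      rw [eq_zero_of_aeval_apply_mem_orbitOrthogonal hf _ hg, map_zero, LinearMap.zero_apply]
      exact (degree_modByMonic_lt g hpm).trans_eq (degree_eq_natDegree hpm.ne_zero)
    · rw [codisjoint_iff, eq_top_iff]
      intro v _
      obtain ⟨g, hg⟩ := exists_sub_aeval_mem_orbitOrthogonal hpm hpM hf v
      exact Submodule.mem_sup.2 ⟨_, hV₁g g, _, hg, by abel⟩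
  have hZV₁ : ∀ Z : Submodule F V, (∀ k < p.natDegree, (M ^ k) x ∈ Z) → V₁ ≤ Z := by
    rintro Z hZ _ ⟨g, rfl⟩
    have h1 : aeval M g = aeval M (g %ₘ p) := (aeval_modByMonic_eq_self_of_root hpM).symm
    change aeval M g x ∈ Z
    rcases eq_or_ne p 1 with h | h
    · simp [h] at hd
    rw [h1, aeval_eq_sum_range' (natDegree_modByMonic_lt _ hpm h), LinearMap.sum_apply]
    exact Z.sum_mem fun k hk => Z.smul_mem _ (hZ k (Finset.mem_range.1 hk))
  rcases eq_or_ne W ⊥ with hW0 | hW0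
  · have hV₁top : V₁ = ⊤ := by
      have := hc.sup_eq_top
      rwa [hW0, sup_bot_eq] at this
    refine ⟨algebraMap F _ a, x, fun v => ?_, by simp, fun Z hxZ hZ => ?_⟩
    · simp only [Module.algebraMap_end_apply, smul_smul]
      module
    · rw [← top_le_iff, ← hV₁top]
      refine hZV₁ Z fun k hk => ?_
      clear hk
      induction k with
      | zero => simpa
      | succ k ihk =>
        have h1 := Z.smul_mem a⁻¹ (hZ _ ihk)
        rw [Module.End.mul_apply, Module.algebraMap_end_apply, map_smul, smul_smul,
          inv_mul_cancel₀ ha, one_smul] at h1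
        rwa [pow_succ', Module.End.mul_apply]
  have hx0 : x ≠ 0 := fun h0 => by
    have := natDegree_le_of_dvd (hx 1 (by simp [h0])) one_ne_zero
    rw [natDegree_one] at this
    omega
  have hdisj := Submodule.disjoint_def.1 hc.disjoint
  obtain ⟨y, hyW, hy0⟩ := Submodule.exists_mem_ne_zero_of_ne_bot hW0
  have hd2 : 2 ≤ p.natDegree := by
    by_contra hlt
    have hMc : ∀ v, M v = (-p.coeff 0) • v := fun v => by
      have := LinearMap.congr_fun hpM v
      rw [hpm.eq_X_add_C (by omega)] at this
      simp only [map_add, aeval_X, aeval_C, LinearMap.add_apply, Module.algebraMap_end_apply,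
        LinearMap.zero_apply] at this
      rw [neg_smul]
      exact eq_neg_of_add_eq_zero_left this
    obtain ⟨s, t, hst, v, hv⟩ := hM (-p.coeff 0) x y (hMc x) (hMc y)
    rw [hMc v, sub_self] at hv
    have h1 : s • x ∈ W := by
      rw [eq_neg_of_add_eq_zero_left hv]
      exact W.neg_mem (W.smul_mem _ hyW)
    have h2 := hdisj _ (V₁.smul_mem s hxV₁) h1
    have hs := (smul_eq_zero.1 h2).resolve_right hx0
    rw [h2, zero_add] at hv
    have ht := (smul_eq_zero.1 hv).resolve_right hy0
    tauto
  have hxW : x ∉ W := fun h => hx0 (hdisj x hxV₁ h)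
  obtain ⟨π, hπW, hπV⟩ : ∃ π : V →ₗ[F] W, (∀ w : W, π w = w) ∧ ∀ v ∈ V₁, π v = 0 :=
    ⟨W.projectionOnto V₁ hc.symm, fun w => Submodule.projectionOnto_apply_left hc.symm w,
      fun v hv => (Submodule.projectionOnto_apply_eq_zero_iff hc.symm).2 hv⟩
  have hdec : ∀ v, ∃ v₁ ∈ V₁, ∃ w : W, v = v₁ + w := fun v => by
    obtain ⟨v₁, h1, w, h2, rfl⟩ := Submodule.mem_sup.1 (hc.sup_eq_top ▸ Submodule.mem_top (x := v))
    exact ⟨v₁, h1, ⟨w, h2⟩, rfl⟩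
  have hMW : ∀ w : W, (M.restrict hWM w : V) = M w := fun w => rfl
  have hπM : ∀ v, π (M v) = M.restrict hWM (π v) := fun v => by
    obtain ⟨v₁, h1, w, rfl⟩ := hdec v
    rw [map_add, map_add, map_add, hπV _ h1, hπV _ (hV₁M _ h1), hπW, zero_add, zero_add, ← hMW, hπW]
  have hπsub : ∀ v, v - π v ∈ V₁ := fun v => by
    obtain ⟨v₁, h1, w, rfl⟩ := hdec v
    rwa [map_add, hπV _ h1, hπW, zero_add, add_sub_cancel_right]
  have hWinj : Function.Injective (M.restrict hWM) := fun v w h =>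
    Subtype.ext (hinj (congrArg Subtype.val h))
  have hWfew : HasFewSimpleCells (M.restrict hWM) := by
    intro c u w hu hw
    obtain ⟨s, t, hst, v, hv⟩ := hM c u w (congrArg Subtype.val hu) (congrArg Subtype.val hw)
    refine ⟨s, t, hst, π v, ?_⟩
    have := congrArg π hv
    simpa only [map_add, map_sub, map_smul, hπW, hπM] using this
  have hWlt : finrank F W < n := by
    rw [← hn]
    exact Submodule.finrank_lt fun h => hxW (h ▸ Submodule.mem_top)
  obtain ⟨S', e, hS', he, hcyc⟩ := ih _ hWlt (M.restrict hWM) rfl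
    (Submodule.nontrivial_iff_ne_bot.2 hW0) hWinj hWfew
  set ξ : Dual F V := f ∘ₗ M ^ (p.natDegree - 1) with hξ
  have hfW : ∀ w : W, f w = 0 := fun w => by simpa using mem_orbitOrthogonal.1 w.2 0
  have hξW : ∀ w : W, ξ w = 0 := fun w => mem_orbitOrthogonal.1 w.2 _
  have hfx : f x = 0 := by
    have := hf 0 (by omega)
    rwa [if_neg (by omega), pow_zero, Module.End.one_apply] at this
  have hξx : ξ x = 1 := by
    have := hf (p.natDegree - 1) (by omega)
    rwa [if_pos (by omega)] at this
  let S : End F V := b • (1 - W.subtype ∘ₗ π) + (a - b) • ξ.smulRight x + W.subtype ∘ₗ S' ∘ₗ π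
    + f.smulRight (e : V)
  have hS : ∀ v, S v = b • (v - π v) + (a - b) • ξ v • x + (S' (π v) : V) + f v • (e : V) :=
    fun v => by simp [S]
  have hSV₁ : ∀ v ∈ V₁, S v = b • v + (a - b) • ξ v • x + f v • (e : V) := fun v hv => by
    simp [hS, hπV v hv]
  have hSW : ∀ w : W, S w = S' w := fun w => by simp [hS, hπW, hfW, hξW]
  have hSx : S x = a • x := by
    rw [hSV₁ x hxV₁, hξx, hfx]
    module
  refine ⟨S, x, fun v => ?_, hSx, fun Z hxZ hZ => ?_⟩
  · obtain ⟨v₁, h1, w, rfl⟩ := hdec v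
    have hw : S (S w) = (a + b) • S w - (a * b) • (w : V) := by
      rw [hSW, hSW, hS']
      rfl
    have hv₁ : S (S v₁) = (a + b) • S v₁ - (a * b) • v₁ := by
      have h2 : S (S v₁) = b • S v₁ + (a - b) • ξ v₁ • S x + f v₁ • S e := by
        conv_lhs => rw [hSV₁ v₁ h1]
        simp only [map_add, map_smul]
      rw [h2, hSx, hSW, he, hSV₁ v₁ h1, Submodule.coe_smul]
      module
    rw [map_add, map_add, hw, hv₁]
    module
  · have hk : ∀ k < p.natDegree, (M ^ k) x ∈ Z := by
      intro k
      induction k with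
      | zero => intro; simpa
      | succ k ihk =>
        intro hk
        have h1 := hZ _ (ihk (by omega))
        have hkV : (M ^ k) x ∈ V₁ := by simpa using hV₁g (X ^ k)
        rw [Module.End.mul_apply, hSV₁ _ hkV, hf k (by omega), if_neg (by omega), zero_smul,
          add_zero, map_add, map_smul, ← Module.End.mul_apply, ← pow_succ'] at h1
        rcases Nat.eq_zero_or_pos k with rfl | hk0
        · have h2 : b • (M ^ (0 + 1)) x + M ((a - b) • ξ ((M ^ 0) x) • x) = a • (M ^ (0 + 1)) x := by
            simp only [zero_add, pow_zero, pow_one, Module.End.one_apply, hξx, map_smul]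
            module
          rw [h2] at h1
          exact (Z.smul_mem_iff ha).1 h1
        · have hMx : M x ∈ Z := by
            have := hZ _ hxZ
            rw [Module.End.mul_apply, hSx, map_smul] at this
            exact (Z.smul_mem_iff ha).1 this
          rw [map_smul, map_smul] at h1
          have h2 := Z.sub_mem h1 (Z.smul_mem (a - b) (Z.smul_mem (ξ ((M ^ k) x)) hMx))
          rw [add_sub_cancel_right] at h2
          exact (Z.smul_mem_iff hb).1 h2
    have hV₁Z := hZV₁ Z hk
    have hMe : M e ∈ Z := by
      have hkV : (M ^ (p.natDegree - 1)) x ∈ V₁ := by simpa using hV₁g (X ^ (p.natDegree - 1))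
      have h1 := hZ _ (hk (p.natDegree - 1) (by omega))
      rw [Module.End.mul_apply, hSV₁ _ hkV, hf _ (by omega), if_pos (by omega), one_smul,
        map_add] at h1
      have h2 := Z.sub_mem h1 (hV₁Z (hV₁M _ (V₁.add_mem (V₁.smul_mem b hkV)
        (V₁.smul_mem (a - b) (V₁.smul_mem (ξ ((M ^ (p.natDegree - 1)) x)) hxV₁)))))
      rwa [add_sub_cancel_left] at h2
    have hWZ : Z.comap W.subtype = ⊤ := by
      refine hcyc.apply_self ?_ _ ?_ fun w hw => ?_
      · exact hWinj.comp (injective_of_quadratic ha hb hS')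
      · change (M (S' e : V) : V) ∈ Z
        rw [he, Submodule.coe_smul, map_smul]
        exact Z.smul_mem _ hMe
      · have := hZ _ hw
        rw [Module.End.mul_apply, Submodule.subtype_apply, hSW] at this
        exact this
    rw [← top_le_iff, ← hc.sup_eq_top]
    refine sup_le hV₁Z fun w hw => ?_
    have : (⟨w, hw⟩ : W) ∈ Z.comap W.subtype := hWZ ▸ Submodule.mem_top
    exact this

end Quadratic

section DualCells

variable {F : Type*} [Field F] {V : Type*} [AddCommGroup V] [Module F V]

theorem HasFewSimpleCells.dualMap {M : End F V} (hM : HasFewSimpleCells M) :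
    HasFewSimpleCells (V := Dual F V) M.dualMap := by
  intro c f g hf hg
  have hf' : ∀ v, f (M v - c • v) = 0 := fun v => by
    have := LinearMap.congr_fun hf v
    rw [map_sub, map_smul, sub_eq_zero]
    exact this
  have hg' : ∀ v, g (M v - c • v) = 0 := fun v => by
    have := LinearMap.congr_fun hg v
    rw [map_sub, map_smul, sub_eq_zero]
    exact this
  have key : ∀ ψ : Dual F V, (∀ x, M x = c • x → ψ x = 0) →
      ∃ θ : Dual F V, ψ = LinearMap.dualMap M θ - c • θ := fun ψ hψ => by
    have h1 : ψ ∈ LinearMap.range (M - c • (1 : End F V)).dualMap := by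
      rw [LinearMap.range_dualMap_eq_dualAnnihilator_ker, Submodule.mem_dualAnnihilator]
      intro x hx
      exact hψ x (sub_eq_zero.1 hx)
    obtain ⟨θ, rfl⟩ := h1
    refine ⟨θ, LinearMap.ext fun v => ?_⟩
    simp
  by_cases h : ∀ x, M x = c • x → f x = 0
  · refine ⟨1, 0, Or.inl one_ne_zero, ?_⟩
    rw [one_smul, zero_smul, add_zero]
    exact key f h
  · push Not at h
    obtain ⟨x, hx, hfx⟩ := h
    refine ⟨g x, -f x, Or.inr (neg_ne_zero.2 hfx), key _ fun y hy => ?_⟩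
    obtain ⟨s, t, hst, v, hv⟩ := hM c x y hx hy
    have h1 := hf' v
    have h2 := hg' v
    rw [← hv] at h1 h2
    simp only [map_add, map_smul, smul_eq_mul] at h1 h2
    simp only [LinearMap.add_apply, LinearMap.smul_apply, smul_eq_mul]
    rcases hst with hs | ht
    · apply mul_left_cancel₀ hs
      linear_combination f y * h2 - g y * h1
    · apply mul_left_cancel₀ ht
      linear_combination g x * h1 - f x * h2

/-- Dual form of `exists_quadratic_isCyclicVector`. -/
theorem exists_quadratic_observable [FiniteDimensional F V] [Nontrivial V] {a b : F} (ha : a ≠ 0)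
    (hb : b ≠ 0) {M : End F V} (hinj : Function.Injective M) (hM : HasFewSimpleCells M) :
    ∃ (S : End F V) (φ : Dual F V), (∀ v, S (S v) = (a + b) • S v - (a * b) • v) ∧
      (∀ v, φ (S v) = a * φ v) ∧ ∀ v, (∀ k, φ (((M * S) ^ k) v) = 0) → v = 0 := by
  obtain ⟨S', φ, hS', hφ, hcyc⟩ := exists_quadratic_isCyclicVector ha hb _
    (V := Dual F V) M.dualMap rfl inferInstance
    (LinearMap.dualMap_injective_iff.2 (LinearMap.injective_iff_surjective.1 hinj)) hM.dualMap
  let S : End F V := (evalEquiv F V).symm.toLinearMap ∘ₗ S'.dualMap ∘ₗ (evalEquiv F V).toLinearMap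
  have hS : ∀ (ψ : Dual F V) v, ψ (S v) = S' ψ v := fun ψ v => by
    simp [S]
  have hSS : ∀ v, S (S v) = (a + b) • S v - (a * b) • v := fun v => by
    rw [← sub_eq_zero, ← forall_dual_apply_eq_zero_iff F]
    intro ψ
    rw [map_sub, map_sub, map_smul, map_smul, hS, hS, hS', hS]
    simp
  have hφS : ∀ v, φ (S v) = a * φ v := fun v => by simp [hS, hφ]
  refine ⟨S, φ, hSS, hφS, fun v hv => ?_⟩
  refine injective_of_quadratic ha hb hSS ?_
  rw [map_zero, ← forall_dual_apply_eq_zero_iff F]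
  have h1 : ∀ k, S * (M * S) ^ k = (S * M) ^ k * S := fun k => by
    induction k with
    | zero => simp
    | succ k ih => rw [pow_succ, ← mul_assoc, ih, pow_succ]; simp only [mul_assoc]
  let Z : Submodule F (Dual F V) :=
    ⨅ k : ℕ, LinearMap.ker (LinearMap.applyₗ (R := F) (M₂ := F) (((S * M) ^ k) (S v)))
  have hZ : ∀ ψ, ψ ∈ Z ↔ ∀ k, ψ (((S * M) ^ k) (S v)) = 0 := fun ψ => by
    simp [Z]
  have hZt : Z = ⊤ := by
    refine hcyc Z ?_ fun ψ hψ => ?_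
    · rw [hZ]
      intro k
      rw [← Module.End.mul_apply, ← h1, Module.End.mul_apply, hφS, hv, mul_zero]
    · rw [hZ] at hψ ⊢
      intro k
      have := hψ (k + 1)
      rwa [pow_succ', Module.End.mul_apply, Module.End.mul_apply, hS] at this
  intro ψ
  have : ψ ∈ Z := hZt ▸ Submodule.mem_top
  simpa using (hZ ψ).1 this 0

theorem exists_apply_pow_eq_of_observable [FiniteDimensional F V] {N : End F V} {φ : Dual F V}
    (h : ∀ v, (∀ k, φ ((N ^ k) v) = 0) → v = 0) :
    ∃ u, ∀ k < finrank F V, φ ((N ^ k) u) = if k + 1 = finrank F V then 1 else 0 := by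
  let P : V →ₗ[F] (Fin (finrank F V) → F) :=
    LinearMap.pi fun k : Fin (finrank F V) => φ ∘ₗ (N ^ (k : ℕ))
  have hP : Function.Injective P := by
    refine (injective_iff_map_eq_zero P).2 fun v hv => h v ?_
    rw [← mem_orbitOrthogonal]
    refine mem_orbitOrthogonal_of_lt N.charpoly_monic N.aeval_self_charpoly fun k hk => ?_
    rw [LinearMap.charpoly_natDegree] at hk
    exact congrFun hv ⟨k, hk⟩
  obtain ⟨u, hu⟩ := (LinearMap.injective_iff_surjective_of_finrank_eq_finrank (by simp)).1 hP
    fun k => if (k : ℕ) + 1 = finrank F V then 1 else 0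
  exact ⟨u, fun k hk => congrFun hu ⟨k, hk⟩⟩

end DualCells

section Completion

variable {F : Type*} [Field F]

theorem natDegree_iterate_divX (p : F[X]) (k : ℕ) :
    (divX^[k] p).natDegree = p.natDegree - k := by
  induction k with
  | zero => rfl
  | succ k ih => rw [Function.iterate_succ_apply', natDegree_divX_eq_natDegree_tsub_one, ih]; omega

theorem Polynomial.Monic.iterate_divX_natDegree {p : F[X]} (hp : p.Monic) :
    divX^[p.natDegree] p = 1 := by
  have h : ∀ k n, (divX^[k] p).coeff n = p.coeff (n + k) := fun k => by
    induction k with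
    | zero => intro n; rfl
    | succ k ih => intro n; rw [Function.iterate_succ_apply', coeff_divX, ih, add_right_comm,
        add_assoc]
  have h1 := natDegree_iterate_divX p p.natDegree
  rw [Nat.sub_self] at h1
  rw [eq_C_of_natDegree_eq_zero h1, h, zero_add, hp.coeff_natDegree, map_one]

theorem iterate_divX_sub_succ (p : F[X]) {b l : ℕ} (hl : l < b) :
    divX^[b - (l + 1)] p = X * divX^[b - l] p + C ((divX^[b - (l + 1)] p).coeff 0) := by
  rw [show b - l = b - (l + 1) + 1 by omega, Function.iterate_succ_apply', mul_comm,
    divX_mul_X_add]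

/-- A multiple `X * R` can be built by Horner steps from polynomials of degree less than `a`. -/
theorem exists_horner_steps {a b : ℕ} (ha : 0 < a) {R : F[X]} (hR : R.natDegree < a + b) :
    ∃ κ r : ℕ → F[X], r 0 = 0 ∧ (∀ l ≤ b, r (l + 1) = X * (r l + κ l)) ∧
      (∀ l, (κ l).natDegree < a) ∧ r (b + 1) = X * R := by
  refine ⟨fun l => if l = 0 then divX^[b] R else C ((divX^[b - l] R).coeff 0),
    fun l => if l = 0 then 0 else X * divX^[b + 1 - l] R, if_pos rfl, fun l hl => ?_, fun l => ?_,
    by simp⟩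
  · rcases Nat.eq_zero_or_pos l with rfl | h0
    · simp
    · have h1 := iterate_divX_sub_succ R (show l < b + 1 by omega)
      rw [Nat.add_sub_add_right] at h1
      simp only [if_neg h0.ne', Nat.succ_ne_zero, if_false, Nat.add_sub_add_right]
      rw [← h1]
  · dsimp only
    split_ifs
    · rw [natDegree_iterate_divX]
      omega
    · simpa using ha

variable {V W : Type*} [AddCommGroup V] [Module F V] [AddCommGroup W] [Module F W]

/-- The endomorphism `(1 + K) ∘ H` of `V × W` where `H` is block triangular with diagonal blocks
`A` and `B` and coupling `φ(·) w`. -/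
def completion (A : End F V) (B : End F W) (φ : Dual F V) (w : W) (K : W →ₗ[F] V) :
    End F (V × W) :=
  (A ∘ₗ LinearMap.fst F V W +
    K ∘ₗ (B ∘ₗ LinearMap.snd F V W + φ.smulRight w ∘ₗ LinearMap.fst F V W)).prod
    (B ∘ₗ LinearMap.snd F V W + φ.smulRight w ∘ₗ LinearMap.fst F V W)

theorem completion_apply (A : End F V) (B : End F W) (φ : Dual F V) (w : W) (K : W →ₗ[F] V)
    (x : V) (y : W) :
    completion A B φ w K (x, y) = (A x + K (B y + φ x • w), B y + φ x • w) := rfl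

theorem aeval_apply_mem_of_invariant {N : End F V} {Z : Submodule F V} (hZ : ∀ x ∈ Z, N x ∈ Z)
    {v : V} (hv : v ∈ Z) (g : F[X]) : aeval N g v ∈ Z := by
  rw [aeval_eq_sum_range, LinearMap.sum_apply]
  exact Z.sum_mem fun k _ => Z.smul_mem _ (Module.End.pow_apply_mem_of_forall_mem k hZ v hv)

section

variable {A : End F V} {B : End F W} {φ : Dual F V} {u : V} {w : W}

theorem completion_pow_apply {a : ℕ} (hu : ∀ k < a, φ ((A ^ k) u) = if k + 1 = a then 1 else 0)
    (K : W →ₗ[F] V) {k : ℕ} (hk : k < a) :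
    (completion A B φ w K ^ k) (u, 0) = ((A ^ k) u, 0) := by
  induction k with
  | zero => simp
  | succ k ih =>
    rw [pow_succ', Module.End.mul_apply, ih (by omega), completion_apply, hu k (by omega),
      if_neg (by omega), zero_smul, map_zero, add_zero, map_zero, add_zero, pow_succ',
      Module.End.mul_apply]

theorem completion_aeval_apply {a : ℕ}
    (hu : ∀ k < a, φ ((A ^ k) u) = if k + 1 = a then 1 else 0)
    (K : W →ₗ[F] V) {g : F[X]} (hg : g.natDegree < a) :
    aeval (completion A B φ w K) g (u, 0) = (aeval A g u, 0) := by
  rw [aeval_eq_sum_range' hg, aeval_eq_sum_range' hg, LinearMap.sum_apply, LinearMap.sum_apply]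
  have hinl : ∀ v : V, ((v, 0) : V × W) = LinearMap.inl F V W v := fun v => rfl
  rw [hinl (Finset.sum _ _), map_sum]
  refine Finset.sum_congr rfl fun k hk => ?_
  rw [LinearMap.smul_apply, completion_pow_apply hu K (Finset.mem_range.1 hk)]
  simp

theorem completion_aeval_apply_of_monic
    {g : F[X]} (hg : g.Monic) (hg0 : 0 < g.natDegree)
    (hu : ∀ k < g.natDegree, φ ((A ^ k) u) = if k + 1 = g.natDegree then 1 else 0)
    (hA : aeval A g = 0) (K : W →ₗ[F] V) :
    aeval (completion A B φ w K) g (u, 0) = (K w, w) := by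
  obtain ⟨d, hd⟩ := Nat.exists_eq_add_one.2 hg0
  have h1 : (completion A B φ w K ^ g.natDegree) (u, 0)
      = ((A ^ g.natDegree) u, 0) + (K w, w) := by
    rw [hd, pow_succ', Module.End.mul_apply, completion_pow_apply hu K (by omega),
      completion_apply, hu d (by omega), if_pos hd.symm, one_smul, map_zero, zero_add, pow_succ',
      Module.End.mul_apply, Prod.mk_add_mk, zero_add]
  have h2 : aeval (completion A B φ w K) g (u, 0) = (aeval A g u, 0) + (K w, w) := by
    rw [aeval_eq_sum_range, aeval_eq_sum_range, Finset.sum_range_succ, Finset.sum_range_succ,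
      hg.coeff_natDegree, one_smul, one_smul, LinearMap.add_apply, LinearMap.add_apply, h1,
      ← add_assoc]
    congr 1
    rw [LinearMap.sum_apply, LinearMap.sum_apply]
    have hinl : ∀ v : V, ((v, 0) : V × W) = LinearMap.inl F V W v := fun v => rfl
    rw [hinl (_ + _), map_add, map_sum]
    congr 1
    refine Finset.sum_congr rfl fun k hk => ?_
    rw [LinearMap.smul_apply, completion_pow_apply hu K (Finset.mem_range.1 hk)]
    simp
  rw [h2, hA, LinearMap.zero_apply, Prod.mk_add_mk, zero_add, zero_add]

theorem isCyclicVector_completion [FiniteDimensional F V] [Nontrivial V]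
    (hobs : ∀ v, (∀ k, φ ((A ^ k) v) = 0) → v = 0)
    (hu : ∀ k < finrank F V, φ ((A ^ k) u) = if k + 1 = finrank F V then 1 else 0)
    (hw : IsCyclicVector B w) (K : W →ₗ[F] V) :
    IsCyclicVector (completion A B φ w K) (u, 0) := by
  intro Z huZ hZ
  have hu' := hu
  rw [← A.charpoly_natDegree] at hu'
  have hpos : 0 < A.charpoly.natDegree := by
    rw [A.charpoly_natDegree]
    exact finrank_pos
  have h1 : ∀ x, (x, (0 : W)) ∈ Z := fun x => by
    obtain ⟨g, hg⟩ := exists_sub_aeval_mem_orbitOrthogonal A.charpoly_monic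
      A.aeval_self_charpoly hu' x
    have hx := sub_eq_zero.1 (hobs _ (mem_orbitOrthogonal.1 hg))
    rw [← aeval_modByMonic_eq_self_of_root A.aeval_self_charpoly] at hx
    rw [hx, ← completion_aeval_apply (w := w) (B := B) hu' K
      (natDegree_modByMonic_lt _ A.charpoly_monic fun h => by simp [h] at hpos)]
    exact aeval_apply_mem_of_invariant hZ huZ _
  have h2 : ((0 : V), w) ∈ Z := by
    have h3 := aeval_apply_mem_of_invariant hZ huZ A.charpoly
    rw [completion_aeval_apply_of_monic A.charpoly_monic hpos hu' A.aeval_self_charpoly K] at h3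
    simpa using Z.sub_mem h3 (h1 (K w))
  have h3 : Z.comap (LinearMap.inr F V W) = ⊤ := by
    refine hw _ h2 fun y hy => ?_
    have h4 := hZ _ hy
    rw [LinearMap.inr_apply, completion_apply] at h4
    simpa using Z.sub_mem h4 (h1 (K (B y)))
  refine eq_top_iff.2 fun v _ => ?_
  have h4 : v.2 ∈ Z.comap (LinearMap.inr F V W) := h3 ▸ Submodule.mem_top
  simpa using Z.add_mem (h1 v.1) h4

theorem coeff_zero_charpoly_eq [FiniteDimensional F V] (Q : End F V) :
    Q.charpoly.coeff 0 = (-1) ^ finrank F V * LinearMap.det Q := by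
  rw [LinearMap.det_eq_sign_charpoly_coeff, ← mul_assoc, ← mul_pow, neg_one_mul, neg_neg,
    one_pow, one_mul]

/-- The completion can be made similar to any endomorphism with a cyclic vector and the right
determinant. -/
theorem exists_completion_similar [FiniteDimensional F V] [Nontrivial V] [FiniteDimensional F W]
    [Nontrivial W] (hobs : ∀ v, (∀ k, φ ((A ^ k) v) = 0) → v = 0) (hw : IsCyclicVector B w)
    {V' : Type*} [AddCommGroup V'] [Module F V'] [FiniteDimensional F V'] {T : End F V'} {v' : V'}
    (hT : IsCyclicVector T v') (hd : finrank F V' = finrank F V + finrank F W)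
    (hdet : LinearMap.det T = LinearMap.det A * LinearMap.det B) :
    ∃ (K : W →ₗ[F] V) (e : (V × W) ≃ₗ[F] V'), ∀ v, e (completion A B φ w K v) = T (e v) := by
  obtain ⟨u, hu⟩ := exists_apply_pow_eq_of_observable hobs
  have ha : 0 < finrank F V := finrank_pos
  have hb : 0 < finrank F W := finrank_pos
  set a := finrank F V with ha'
  obtain ⟨b, hb'⟩ : ∃ b, finrank F W = b + 1 := ⟨_, (Nat.sub_add_cancel hb).symm⟩
  set p := T.charpoly with hp
  have hpd : p.natDegree = a + (b + 1) := by rw [hp, LinearMap.charpoly_natDegree, hd, hb']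
  set D := A.charpoly * B.charpoly - p with hD
  have hD0 : D.coeff 0 = 0 := by
    rw [hD, coeff_sub, mul_coeff_zero, hp, coeff_zero_charpoly_eq, coeff_zero_charpoly_eq,
      coeff_zero_charpoly_eq, hdet, hd, pow_add]
    ring
  have hDd : D.natDegree < a + (b + 1) := by
    have hm := A.charpoly_monic.mul B.charpoly_monic
    have hmd : (A.charpoly * B.charpoly).natDegree = a + (b + 1) := by
      rw [A.charpoly_monic.natDegree_mul B.charpoly_monic, A.charpoly_natDegree,
        B.charpoly_natDegree, hb']
    rcases eq_or_ne D 0 with h0 | h0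
    · rw [h0, natDegree_zero]
      omega
    · rw [natDegree_lt_iff_degree_lt h0, ← hmd, ← degree_eq_natDegree hm.ne_zero]
      refine degree_sub_lt_left ?_ hm.ne_zero ?_
      · rw [degree_eq_natDegree hm.ne_zero, degree_eq_natDegree T.charpoly_monic.ne_zero, hmd, hpd]
      · rw [hm.leadingCoeff, T.charpoly_monic.leadingCoeff]
  obtain ⟨R, hR, hRd⟩ : ∃ R, D = X * R ∧ R.natDegree < a + b := by
    refine ⟨divX D, ?_, ?_⟩
    · conv_lhs => rw [← divX_mul_X_add D, hD0, map_zero, add_zero, mul_comm]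
    · rw [natDegree_divX_eq_natDegree_tsub_one]
      omega
  obtain ⟨κ, r, hr0, hr, hκ, hrb⟩ := exists_horner_steps ha hRd
  set f : ℕ → F[X] := fun l => divX^[b + 1 - l] B.charpoly with hf
  have hf0 : f 0 = 1 := by
    have := B.charpoly_monic.iterate_divX_natDegree
    rwa [B.charpoly_natDegree, hb'] at this
  have hfb : f (b + 1) = B.charpoly := by simp [hf]
  have hfs : ∀ l < b + 1, f (l + 1) = X * f l + C ((f (l + 1)).coeff 0) := fun l hl =>
    iterate_divX_sub_succ _ hl
  set h : ℕ → W := fun l => aeval B (f l) w with hh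
  have hh0 : h 0 = w := by simp [hh, hf0]
  have hhb : h (b + 1) = 0 := by simp [hh, hfb, LinearMap.aeval_self_charpoly]
  have hhs : ∀ l < b + 1, h (l + 1) = B (h l) + (f (l + 1)).coeff 0 • w := fun l hl => by
    simp only [hh]
    conv_lhs => rw [hfs l hl]
    simp
  have hspan : Submodule.span F (Set.range fun l : Fin (b + 1) => h l) = ⊤ := by
    have hmem : ∀ l ≤ b + 1, h l ∈ Submodule.span F (Set.range fun l : Fin (b + 1) => h l) :=
      fun l hl => by
        rcases hl.lt_or_eq with hl | rfl
        · exact Submodule.subset_span ⟨⟨l, hl⟩, rfl⟩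
        · rw [hhb]
          exact Submodule.zero_mem _
    refine hw _ (hh0 ▸ hmem 0 (by omega)) fun x hx => ?_
    refine (Submodule.span_le (p := Submodule.comap B
      (Submodule.span F (Set.range fun l : Fin (b + 1) => h l)))).2 ?_ hx
    rintro _ ⟨l, rfl⟩
    have h1 := hmem (l + 1) l.2
    rw [hhs l l.2] at h1
    have h2 := hmem 0 (by omega)
    rw [hh0] at h2
    have h3 := Submodule.sub_mem _ h1 (Submodule.smul_mem _ ((f (l + 1)).coeff 0) h2)
    rwa [add_sub_cancel_right] at h3
  set bas := basisOfTopLeSpanOfCardEqFinrank _ hspan.ge (by simp [hb']) with hbas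
  obtain ⟨K, hK⟩ : ∃ K : W →ₗ[F] V, ∀ l < b + 1, K (h l) = aeval A (κ l) u := by
    refine ⟨bas.constr F fun l => aeval A (κ l) u, fun l hl => ?_⟩
    have h1 := bas.constr_basis F (fun l : Fin (b + 1) => aeval A (κ l) u) ⟨l, hl⟩
    rwa [hbas, coe_basisOfTopLeSpanOfCardEqFinrank] at h1
  set N := completion A B φ w K with hN
  have hτ : ∀ y, N (K y, y) = (K (B y), B y) + N (K y, 0) := fun y => by
    simp only [hN, completion_apply, map_add, map_zero, zero_add, Prod.mk_add_mk]
    congr 1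
    abel
  have hind : ∀ l ≤ b + 1, aeval N (f l) (K w, w) = (K (h l), h l) + aeval N (r l) (u, 0) := by
    intro l
    induction l with
    | zero => intro; simp [hf0, hr0, hh0]
    | succ l ih =>
      intro hl
      rw [hfs l (by omega), hr l (by omega), hhs l (by omega)]
      simp only [map_add, map_mul, aeval_X, aeval_C, LinearMap.add_apply, Module.End.mul_apply,
        Module.algebraMap_end_apply, ih (by omega), hτ, map_smul]
      rw [hN, completion_aeval_apply hu K (hκ l), ← hK l (by omega)]
      rw [show ((K (B (h l)) + (f (l + 1)).coeff 0 • K w, B (h l) + (f (l + 1)).coeff 0 • w) : V × W)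
        = (K (B (h l)), B (h l)) + (f (l + 1)).coeff 0 • (K w, w) from rfl]
      abel
  have hpN : aeval N p (u, 0) = 0 := by
    have h1 := hind (b + 1) le_rfl
    rw [hfb, hhb, hrb, ← hR, map_zero, ← Prod.zero_eq_mk, zero_add] at h1
    have hu' := hu
    rw [ha', ← A.charpoly_natDegree] at hu'
    rw [← completion_aeval_apply_of_monic (B := B) A.charpoly_monic
      (by rwa [A.charpoly_natDegree]) hu' A.aeval_self_charpoly K, ← Module.End.mul_apply,
      ← map_mul, mul_comm, hD, map_sub, LinearMap.sub_apply] at h1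
    exact sub_eq_self.1 h1.symm
  obtain ⟨e, he⟩ := exists_linearEquiv_of_isCyclicVector
    (isCyclicVector_completion hobs hu hw K) hT T.charpoly_monic hpN
    (by simp [LinearMap.aeval_self_charpoly])
    (by rw [finrank_prod, LinearMap.charpoly_natDegree, hd]) (by rw [LinearMap.charpoly_natDegree])
  exact ⟨K, e, he⟩

end

end Completion

section Block

variable {F : Type*} [Field F] {V W : Type*} [AddCommGroup V] [Module F V] [AddCommGroup W]
  [Module F W]

theorem det_eq_one_or_of_quadratic [FiniteDimensional F V] {S : End F V} {β : F}
    (hβ : β = 1 ∨ β = -1) (hS : ∀ v, S (S v) = (1 + β) • S v - (1 * β) • v) :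
    (LinearMap.det S = 1 ∨ LinearMap.det S = -1) ∧ (β = 1 → LinearMap.det S = 1) := by
  have h1 : β = 1 → LinearMap.det S = 1 := by
    rintro rfl
    have hnil : IsNilpotent (1 - S) := by
      refine ⟨2, LinearMap.ext fun v => ?_⟩
      rw [pow_two, Module.End.mul_apply]
      simp only [LinearMap.sub_apply, Module.End.one_apply, map_sub, hS, LinearMap.zero_apply]
      module
    have h2 := LinearMap.eval_charpoly (1 - S) 1
    rw [IsNilpotent.charpoly_eq_X_pow_finrank hnil] at h2
    simpa using h2.symm
  refine ⟨?_, h1⟩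
  rcases hβ with h | rfl
  · exact Or.inl (h1 h)
  · rw [← mul_self_eq_one_iff, ← map_mul]
    have : S * S = 1 := LinearMap.ext fun v => by simp [hS]
    rw [this, map_one]

theorem exists_sylvester [FiniteDimensional F V] [FiniteDimensional F W] {A : End F V}
    {B : End F W} {f g : F[X]} (hfg : IsCoprime f g) (hA : aeval A f = 0) (hB : aeval B g = 0)
    (Y : W →ₗ[F] V) : ∃ X : W →ₗ[F] V, X ∘ₗ B - A ∘ₗ X = Y := by
  let L : (W →ₗ[F] V) →ₗ[F] (W →ₗ[F] V) := LinearMap.lcomp F V B - LinearMap.llcomp F W V V A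
  have hL : ∀ X, L X = X ∘ₗ B - A ∘ₗ X := fun X => rfl
  suffices h : Function.Injective L from LinearMap.injective_iff_surjective.1 h Y
  refine (injective_iff_map_eq_zero L).2 fun X hX => ?_
  rw [hL, sub_eq_zero] at hX
  have hc : ∀ (q : F[X]) y, X (aeval B q y) = aeval A q (X y) := fun q => by
    induction q using Polynomial.induction_on' with
    | add p q hp hq => intro y; simp [hp, hq]
    | monomial n c =>
      intro y
      have h1 : X ((B ^ n) y) = (A ^ n) (X y) := by
        induction n with
        | zero => rfl
        | succ n ih =>
          rw [pow_succ', pow_succ', Module.End.mul_apply, Module.End.mul_apply, ← ih]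
          exact LinearMap.congr_fun hX _
      simp [aeval_monomial, h1]
  obtain ⟨p, q, hpq⟩ := hfg
  ext y
  have h1 := congrArg (fun r => aeval A r (X y)) hpq
  simp only [map_add, map_mul, hA, mul_zero, zero_add, Module.End.mul_apply, ← hc, hB,
    LinearMap.zero_apply, map_zero, map_one, Module.End.one_apply] at h1
  exact h1.symm

theorem IsCyclicVector.of_smul {N : End F V} {v : V} {c : F} (h : IsCyclicVector N (c • v)) :
    IsCyclicVector N v :=
  fun Z hv hZ => h Z (Z.smul_mem c hv) hZ

/-- A block diagonal endomorphism with coprime blocks, each with few simple cells, becomes similar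
to a prescribed cyclic endomorphism after right multiplication by a quadratic endomorphism. -/
theorem exists_quadratic_mul_similar [FiniteDimensional F V] [Nontrivial V]
    [FiniteDimensional F W] [Nontrivial W] {A : End F V} {B : End F W}
    (hA : Function.Injective A) (hB : Function.Injective B) (hAc : HasFewSimpleCells A)
    (hBc : HasFewSimpleCells B) {f g : F[X]} (hfg : IsCoprime f g) (hAf : aeval A f = 0)
    (hBg : aeval B g = 0) {β : F} (hβ : β = 1 ∨ β = -1) {V' : Type*} [AddCommGroup V'] [Module F V']
    [FiniteDimensional F V'] (hd : finrank F V' = finrank F V + finrank F W) :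
    ∃ δ : F, (δ = 1 ∨ δ = -1) ∧ (β = 1 → δ = 1) ∧ ∀ (T : End F V') (v' : V'),
      IsCyclicVector T v' → LinearMap.det T = LinearMap.det A * LinearMap.det B * δ →
      ∃ (S : End F V') (e : (V × W) ≃ₗ[F] V'), (∀ v, S (S v) = (1 + β) • S v - (1 * β) • v) ∧
        ∀ y, e (A.prodMap B (e.symm (S y))) = T y := by
  have hβ0 : β ≠ 0 := by
    rcases hβ with rfl | rfl
    exacts [one_ne_zero, neg_ne_zero.2 one_ne_zero]
  obtain ⟨S, φ, hS, hφ, hobs⟩ := exists_quadratic_observable one_ne_zero hβ0 hA hAc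
  obtain ⟨R, w, hR, hRw, hcyc⟩ :=
    exists_quadratic_isCyclicVector hβ0 one_ne_zero _ B rfl inferInstance hB hBc
  replace hR : ∀ v, R (R v) = (1 + β) • R v - (1 * β) • v := fun v => by
    rw [hR, add_comm, mul_comm]
  have hBR : Function.Injective (B * R) := hB.comp (injective_of_quadratic one_ne_zero hβ0 hR)
  have hcyc' : IsCyclicVector (B * R) (B w) := by
    have := hcyc.apply_self hBR
    rw [Module.End.mul_apply, hRw, map_smul] at this
    exact this.of_smul
  obtain ⟨hS1, hS2⟩ := det_eq_one_or_of_quadratic hβ hS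
  obtain ⟨hR1, hR2⟩ := det_eq_one_or_of_quadratic hβ hR
  refine ⟨LinearMap.det S * LinearMap.det R, ?_, fun h => ?_, fun T v' hT hdet => ?_⟩
  · rcases hS1 with h | h <;> rcases hR1 with h' | h' <;> simp [h, h']
  · rw [hS2 h, hR2 h, mul_one]
  obtain ⟨K, e, he⟩ := exists_completion_similar hobs hcyc' hT hd (by
    rw [hdet, map_mul, map_mul]
    ring)
  obtain ⟨X, hX⟩ := exists_sylvester hfg hAf hBg (K ∘ₗ B)
  let S₀ : End F (V × W) := (S ∘ₗ LinearMap.fst F V W).prod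
    (R ∘ₗ LinearMap.snd F V W + φ.smulRight w ∘ₗ LinearMap.fst F V W)
  have hS₀ : ∀ x y, S₀ (x, y) = (S x, R y + φ x • w) := fun x y => rfl
  let P : (V × W) ≃ₗ[F] (V × W) :=
    { toFun := fun v => (v.1 + X v.2, v.2)
      invFun := fun v => (v.1 - X v.2, v.2)
      map_add' := fun v v' => by
        ext <;> simp
        abel
      map_smul' := fun c v => by ext <;> simp
      left_inv := fun v => by simp
      right_inv := fun v => by simp }
  have hP : ∀ x y, P (x, y) = (x + X y, y) := fun x y => rfl
  have hPM : ∀ x y, P (A.prodMap B (P.symm (x, y))) = (A x + K (B y), B y) := fun x y => by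
    have h1 := LinearMap.congr_fun hX y
    simp only [LinearMap.sub_apply, LinearMap.comp_apply] at h1
    have h2 : P.symm (x, y) = (x - X y, y) := rfl
    rw [h2, LinearMap.prodMap_apply, hP, ← h1, map_sub]
    congr 1
    abel
  refine ⟨e.toLinearMap ∘ₗ S₀ ∘ₗ e.symm.toLinearMap, P ≪≫ₗ e, fun v => ?_, fun y => ?_⟩
  · obtain ⟨⟨x, y⟩, rfl⟩ := e.surjective v
    simp only [LinearMap.comp_apply, LinearEquiv.coe_coe, LinearEquiv.symm_apply_apply]
    rw [← map_smul e, ← map_smul e, ← map_sub e, hS₀, hS₀, map_add, map_smul, hR, hS, hRw, hφ]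
    congr 1
    simp only [Prod.smul_mk, Prod.mk_sub_mk]
    congr 1
    module
  · obtain ⟨⟨x, y⟩, rfl⟩ := e.surjective y
    simp only [LinearMap.comp_apply, LinearEquiv.coe_coe, LinearEquiv.symm_apply_apply,
      LinearEquiv.trans_apply, LinearEquiv.trans_symm]
    rw [hS₀, hPM, ← he, completion_apply]
    simp

end Block

section Splitting

variable {F : Type*} [Field F] {V : Type*} [AddCommGroup V] [Module F V]

theorem Irreducible.dvd_of_dvd_charpoly [FiniteDimensional F V] {M : End F V} {q f : F[X]}
    (hq : Irreducible q) (hqM : q ∣ M.charpoly) (hf : aeval M f = 0) : q ∣ f := by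
  have : Fact (Irreducible q) := ⟨hq⟩
  have hroot : ((M.baseChange (AdjoinRoot q)).charpoly).IsRoot (AdjoinRoot.root q) := by
    rwa [LinearMap.charpoly_baseChange, IsRoot.def, eval_map_algebraMap, AdjoinRoot.aeval_eq,
      AdjoinRoot.mk_eq_zero]
  obtain ⟨v, hv⟩ := ((Module.End.hasEigenvalue_iff_isRoot_charpoly _ _).2 hroot).exists_hasEigenvector
  have h1 := Module.End.aeval_apply_of_hasEigenvector (p := f.map (algebraMap F (AdjoinRoot q))) hv
  have h2 : aeval (M.baseChange (AdjoinRoot q)) (f.map (algebraMap F (AdjoinRoot q))) = 0 := by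
    rw [aeval_map_algebraMap]
    change aeval (Module.End.baseChangeHom F (AdjoinRoot q) V M) f = 0
    rw [aeval_algHom_apply, hf, map_zero]
  rw [h2, LinearMap.zero_apply, eq_comm, smul_eq_zero] at h1
  have h3 := h1.resolve_right hv.2
  rwa [eval_map_algebraMap, AdjoinRoot.aeval_eq, AdjoinRoot.mk_eq_zero] at h3

theorem HasFewSimpleCells.restrict {M : End F V} (hM : HasFewSimpleCells M) {V₁ V₂ : Submodule F V}
    (hc : IsCompl V₁ V₂) (h₁ : ∀ v ∈ V₁, M v ∈ V₁) (h₂ : ∀ v ∈ V₂, M v ∈ V₂) :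
    HasFewSimpleCells (M.restrict h₁) := by
  intro c x y hx hy
  obtain ⟨s, t, hst, v, hv⟩ := hM c x y (congrArg Subtype.val hx) (congrArg Subtype.val hy)
  obtain ⟨v₁, hv₁, v₂, hv₂, rfl⟩ :=
    Submodule.mem_sup.1 (hc.sup_eq_top ▸ Submodule.mem_top (x := v))
  refine ⟨s, t, hst, ⟨v₁, hv₁⟩, Subtype.ext ?_⟩
  change s • (x : V) + t • (y : V) = M v₁ - c • v₁
  rw [← sub_eq_zero]
  have h : s • (x : V) + t • (y : V) - (M v₁ - c • v₁) = M v₂ - c • v₂ := by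
    rw [hv, map_add]
    module
  refine Submodule.disjoint_def.1 hc.disjoint _ ?_ ?_
  · exact V₁.sub_mem (V₁.add_mem (V₁.smul_mem _ x.2) (V₁.smul_mem _ y.2))
      (V₁.sub_mem (h₁ _ hv₁) (V₁.smul_mem _ hv₁))
  · rw [h]
    exact V₂.sub_mem (h₂ _ hv₂) (V₂.smul_mem _ hv₂)

theorem exists_isCoprime_ker_ne_bot [FiniteDimensional F V] {M : End F V}
    (hM : ¬ ∃ (q : F[X]) (m : ℕ), Irreducible q ∧ M.charpoly = q ^ m) :
    ∃ f g : F[X], IsCoprime f g ∧ aeval M (f * g) = 0 ∧ LinearMap.ker (aeval M f) ≠ ⊥ ∧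
      LinearMap.ker (aeval M g) ≠ ⊥ := by
  have h1 : M.charpoly ≠ 1 := fun h => hM ⟨X, 0, irreducible_X, by rw [h, pow_zero]⟩
  obtain ⟨q, hqm, hq, hqd⟩ := exists_monic_irreducible_factor M.charpoly
    fun h => h1 (M.charpoly_monic.isUnit_iff.1 h)
  obtain ⟨c, hc, hqc⟩ := (FiniteMultiplicity.of_not_isUnit hq.not_isUnit
    M.charpoly_monic.ne_zero).exists_eq_pow_mul_and_not_dvd
  generalize multiplicity q M.charpoly = m at hc
  have hcm : c.Monic := (hqm.pow m).of_mul_monic_left (hc ▸ M.charpoly_monic)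
  have h0 : aeval M (q ^ m * c) = 0 := by rw [← hc, M.aeval_self_charpoly]
  refine ⟨q ^ m, c, (hq.coprime_iff_not_dvd.2 hqc).pow_left, h0, fun h => hqc ?_, fun h => ?_⟩
  · refine hq.dvd_of_dvd_charpoly hqd (LinearMap.ext fun v => ?_)
    refine LinearMap.ker_eq_bot'.1 h _ ?_
    rw [← Module.End.mul_apply, ← map_mul, h0, LinearMap.zero_apply]
  · have hcu : ¬ IsUnit c := fun hcu => hM ⟨q, m, hq, by
      rw [hc, hcm.isUnit_iff.1 hcu, mul_one]⟩
    obtain ⟨r, hrm, hr, hrd⟩ := exists_monic_irreducible_factor c hcu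
    have h2 : r ∣ q ^ m := by
      refine hr.dvd_of_dvd_charpoly (hc ▸ hrd.mul_left _) (LinearMap.ext fun v => ?_)
      refine LinearMap.ker_eq_bot'.1 h _ ?_
      rw [← Module.End.mul_apply, ← map_mul, mul_comm, h0, LinearMap.zero_apply]
    exact hqc (((hr.dvd_symm hq (hr.prime.dvd_of_dvd_pow h2))).trans hrd)

theorem coe_aeval_restrict_apply {M : End F V} {K : Submodule F V} (h : ∀ v ∈ K, M v ∈ K) (f : F[X])
    (v : K) : (aeval (M.restrict h) f v : V) = aeval M f v := by
  rw [aeval_eq_sum_range, aeval_eq_sum_range, LinearMap.sum_apply, LinearMap.sum_apply,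
    Submodule.coe_sum]
  refine Finset.sum_congr rfl fun k _ => ?_
  rw [LinearMap.smul_apply, LinearMap.smul_apply, Module.End.pow_restrict]
  rfl

theorem aeval_restrict_ker_eq_zero {M : End F V} {f : F[X]}
    (h : ∀ v ∈ LinearMap.ker (aeval M f), M v ∈ LinearMap.ker (aeval M f)) :
    aeval (M.restrict h) f = 0 :=
  LinearMap.ext fun v => Subtype.ext ((coe_aeval_restrict_apply h f v).trans v.2)

/-- Multiplicative form: under the hypotheses of the main theorem, `M` is similar to a prescribed
cyclic endomorphism up to a quadratic factor. -/
theorem exists_quadratic_mul_similar_of_charpoly [FiniteDimensional F V] {M : End F V}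
    (hinj : Function.Injective M) (hMc : HasFewSimpleCells M)
    (hM : ¬ ∃ (q : F[X]) (m : ℕ), Irreducible q ∧ M.charpoly = q ^ m) {β : F}
    (hβ : β = 1 ∨ β = -1) {V' : Type*} [AddCommGroup V'] [Module F V'] [FiniteDimensional F V']
    (hd : finrank F V' = finrank F V) :
    ∃ δ : F, (δ = 1 ∨ δ = -1) ∧ (β = 1 → δ = 1) ∧ ∀ (T : End F V') (v' : V'),
      IsCyclicVector T v' → LinearMap.det T = LinearMap.det M * δ →
      ∃ (S : End F V') (e : V ≃ₗ[F] V'), (∀ v, S (S v) = (1 + β) • S v - (1 * β) • v) ∧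
        ∀ y, e (M (e.symm (S y))) = T y := by
  obtain ⟨f, g, hfg, h0, hf, hg⟩ := exists_isCoprime_ker_ne_bot hM
  have hinv : ∀ (p : F[X]), ∀ v ∈ LinearMap.ker (aeval M p), M v ∈ LinearMap.ker (aeval M p) :=
    fun p v hv => by
      rw [LinearMap.mem_ker] at hv ⊢
      have h1 : aeval M p (M v) = M (aeval M p v) := by
        have := congrArg (fun r => aeval M r v) (mul_comm p X)
        simpa using this
      rw [h1, hv, map_zero]
  have hc : IsCompl (LinearMap.ker (aeval M f)) (LinearMap.ker (aeval M g)) :=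
    ⟨disjoint_ker_aeval_of_isCoprime M hfg, codisjoint_iff.2 (by
      rw [sup_ker_aeval_eq_ker_aeval_mul_of_coprime M hfg, h0, LinearMap.ker_zero])⟩
  have := Submodule.nontrivial_iff_ne_bot.2 hf
  have := Submodule.nontrivial_iff_ne_bot.2 hg
  let E := Submodule.prodEquivOfIsCompl _ _ hc
  have hE : ∀ v, E ((M.restrict (hinv f)).prodMap (M.restrict (hinv g)) v) = M (E v) := fun v => by
    simp [E]
  have hdet : LinearMap.det M
      = LinearMap.det (M.restrict (hinv f)) * LinearMap.det (M.restrict (hinv g)) := by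
    rw [← LinearMap.det_prodMap, ← LinearMap.det_conj _ E]
    refine congrArg _ (LinearMap.ext fun v => ?_)
    obtain ⟨v, rfl⟩ := E.surjective v
    rw [LinearMap.comp_apply, LinearMap.comp_apply, LinearEquiv.coe_coe, LinearEquiv.coe_coe,
      LinearEquiv.symm_apply_apply, hE]
  have hinj' : ∀ p, Function.Injective (M.restrict (hinv p)) := fun p v w h =>
    Subtype.ext (hinj (congrArg Subtype.val h))
  obtain ⟨δ, hδ, hδ', h⟩ := exists_quadratic_mul_similar (hinj' f) (hinj' g)
    (hMc.restrict hc (hinv f) (hinv g)) (hMc.restrict hc.symm (hinv g) (hinv f)) hfg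
    (aeval_restrict_ker_eq_zero _) (aeval_restrict_ker_eq_zero _) hβ (V' := V')
    (by rw [hd, ← finrank_prod, E.finrank_eq])
  refine ⟨δ, hδ, hδ', fun T v' hT hT' => ?_⟩
  obtain ⟨S, e, hS, he⟩ := h T v' hT (by rw [hT', hdet])
  refine ⟨S, E.symm ≪≫ₗ e, hS, fun y => ?_⟩
  rw [← he]
  simp only [LinearEquiv.trans_apply, LinearEquiv.trans_symm, LinearEquiv.symm_symm, ← hE,
    LinearEquiv.symm_apply_apply]

end Splitting

section Bidiagonal

variable {F : Type*} [Field F]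

/-- The endomorphism of `Fin n → F` whose matrix is lower bidiagonal, with diagonal `d` and
subdiagonal entry `c i` in row `i`. -/
def bidiagonal (n : ℕ) (d c : ℕ → F) : End F (Fin n → F) where
  toFun v i := d i * v i + c i * v ⟨i - 1, lt_of_le_of_lt (Nat.sub_le _ _) i.2⟩
  map_add' v w := by ext i; simp only [Pi.add_apply]; ring
  map_smul' a v := by ext i; simp only [Pi.smul_apply, smul_eq_mul, RingHom.id_apply]; ring

theorem bidiagonal_apply (n : ℕ) (d c : ℕ → F) (v : Fin n → F) (i : Fin n) :
    bidiagonal n d c v i = d i * v i + c i * v ⟨i - 1, lt_of_le_of_lt (Nat.sub_le _ _) i.2⟩ :=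
  rfl

theorem bidiagonal_quadratic {n : ℕ} {d c : ℕ → F} {β : F} (hd : ∀ i, d i = 1 ∨ d i = β)
    (hc : ∀ i, c i = 0 ∨ c (i - 1) = 0 ∧ d i + d (i - 1) = 1 + β) (v : Fin n → F) :
    bidiagonal n d c (bidiagonal n d c v) = (1 + β) • bidiagonal n d c v - (1 * β) • v := by
  ext i
  simp only [bidiagonal_apply, Pi.sub_apply, Pi.smul_apply, smul_eq_mul]
  have h : (d i - 1) * (d i - β) = 0 := by
    rcases hd i with h | h <;> rw [h] <;> ring
  rcases hc i with hc | ⟨hc, hs⟩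
  · rw [hc]
    linear_combination v i * h
  · rw [hc]
    linear_combination v i * h + c i * v ⟨i - 1, lt_of_le_of_lt (Nat.sub_le _ _) i.2⟩ * hs

theorem det_bidiagonal (n : ℕ) {d c : ℕ → F} (hc : c 0 = 0) :
    LinearMap.det (bidiagonal n d c) = ∏ i : Fin n, d i := by
  rw [← LinearMap.det_toMatrix', Matrix.det_of_isLowerTriangular]
  · refine Finset.prod_congr rfl fun i _ => ?_
    rw [LinearMap.toMatrix'_apply, bidiagonal_apply, Pi.single_eq_same, mul_one, add_eq_left]
    rcases Nat.eq_zero_or_pos i with h | h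
    · simp [h, hc]
    · rw [Pi.single_eq_of_ne (by rw [Ne, Fin.ext_iff]; simp only; omega), mul_zero]
  · intro i j hij
    have hij : (i : ℕ) < j := hij
    rw [LinearMap.toMatrix'_apply, bidiagonal_apply,
      Pi.single_eq_of_ne (by rw [Ne, Fin.ext_iff]; omega),
      Pi.single_eq_of_ne (by rw [Ne, Fin.ext_iff]; simp only; omega), mul_zero, mul_zero, add_zero]

/-- The `k`-th standard basis vector, or `0` if `k` is out of range. -/
def stdVec (F : Type*) [Field F] (n k : ℕ) : Fin n → F := fun i => if (i : ℕ) = k then 1 else 0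

theorem bidiagonal_stdVec (n : ℕ) {d c : ℕ → F} (hc : c 0 = 0) (k : ℕ) :
    bidiagonal n d c (stdVec F n k) = d k • stdVec F n k + c (k + 1) • stdVec F n (k + 1) := by
  ext i
  simp only [bidiagonal_apply, stdVec, Pi.add_apply, Pi.smul_apply, smul_eq_mul, mul_ite, mul_one,
    mul_zero]
  rcases Nat.eq_zero_or_pos i with h | h
  · rw [h, hc]
    by_cases hk : k = 0 <;> simp [hk, eq_comm]
  · congr 1
    · split_ifs with h <;> simp_all
    · by_cases h' : (i : ℕ) = k + 1
      · rw [if_pos h', if_pos (by omega), h']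
      · rw [if_neg h', if_neg (by omega)]

theorem eq_top_of_stdVec_mem {n : ℕ} {Z : Submodule F (Fin n → F)} (h : ∀ k, stdVec F n k ∈ Z) :
    Z = ⊤ := by
  refine Submodule.eq_top_iff'.2 fun v => ?_
  have hv : v = ∑ i : Fin n, v i • stdVec F n i := by
    ext j
    simp [stdVec, Finset.sum_apply, Fin.val_inj]
  rw [hv]
  exact Submodule.sum_mem _ fun i _ => Z.smul_mem _ (h i)

theorem mem_of_apply_mem_of_invariant {V : Type*} [AddCommGroup V] [Module F V]
    [FiniteDimensional F V] {T : End F V} (hT : Function.Injective T) {Z : Submodule F V}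
    (hZ : ∀ x ∈ Z, T x ∈ Z) {x : V} (hx : T x ∈ Z) : x ∈ Z := by
  have h : Z.map T = Z := Submodule.eq_of_le_of_finrank_eq
    (Submodule.map_le_iff_le_comap.2 hZ) (Submodule.equivMapOfInjective T hT Z).finrank_eq.symm
  rw [← h] at hx
  obtain ⟨z, hz, hzx⟩ := hx
  exact hT hzx ▸ hz

/-- There is a cyclic product of two quadratic endomorphisms of prescribed types, whose determinant
can be prescribed as well if the second factor is an involution. -/
theorem exists_quadratic_mul_quadratic_isCyclicVector {n : ℕ} (hn : n ≠ 0) {β γ η : F}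
    (hβ : β = 1 ∨ β = -1) (hγ : γ = 1 ∨ γ = -1) (hη : η = 1 ∨ η = -1)
    (h : γ = -1 ∨ β = 1 ∧ γ = 1 ∧ η = 1) :
    ∃ (P Q : End F (Fin n → F)) (v : Fin n → F),
      (∀ v, P (P v) = (1 + β) • P v - (1 * β) • v) ∧
      (∀ v, Q (Q v) = (1 + γ) • Q v - (1 * γ) • v) ∧
      IsCyclicVector (P * Q) v ∧ LinearMap.det (P * Q) = η := by
  obtain ⟨m, rfl⟩ := Nat.exists_eq_succ_of_ne_zero hn
  let dP : ℕ → F := fun i => if Even i then 1 else β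
  let cP : ℕ → F := fun i => if Even i then 0 else 1
  let dQ : F → ℕ → F := fun ε i => if i = 0 then ε else if Even i then γ else 1
  let cQ : ℕ → F := fun i => if i = 0 then 0 else if Even i then 1 else 0
  have hβ2 : β * β = 1 := by rcases hβ with rfl | rfl <;> ring
  have hγ2 : γ * γ = 1 := by rcases hγ with rfl | rfl <;> ring
  let P := bidiagonal (m + 1) dP cP
  let Q := fun ε => bidiagonal (m + 1) (dQ ε) cQ
  have hP : ∀ v, P (P v) = (1 + β) • P v - (1 * β) • v := by
    refine bidiagonal_quadratic (fun i => ?_) (fun i => ?_)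
    · by_cases hi : Even i <;> simp [dP, hi]
    · by_cases hi : Even i
      · simp [cP, hi]
      · have h1 : Even (i - 1) := by grind
        right
        simp [cP, dP, hi, h1, add_comm]
  have hQ : ∀ ε, (ε = 1 ∨ ε = γ) → ∀ v, Q ε (Q ε v) = (1 + γ) • Q ε v - (1 * γ) • v := by
    intro ε hε
    refine bidiagonal_quadratic (fun i => ?_) (fun i => ?_)
    · by_cases h0 : i = 0
      · simpa [dQ, h0] using hε
      · by_cases hi : Even i <;> simp [dQ, hi, h0]
    · by_cases h0 : i = 0
      · simp [cQ, h0]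
      · by_cases hi : Even i
        · have h1 : ¬ Even (i - 1) := by grind
          have h2 : i - 1 ≠ 0 := by grind
          right
          simp only [cQ, dQ, hi, h1, h2, h0, if_true, if_false]
          exact ⟨trivial, add_comm _ _⟩
        · simp [cQ, hi]
  have hdetQ : ∀ ε, LinearMap.det (Q ε) = ε * LinearMap.det (Q 1) := fun ε => by
    rw [det_bidiagonal _ (by simp [cQ]), det_bidiagonal _ (by simp [cQ]), Fin.prod_univ_succ,
      Fin.prod_univ_succ]
    simp [dQ]
  obtain ⟨ε, hε, hdet⟩ : ∃ ε, (ε = 1 ∨ ε = γ) ∧ LinearMap.det (P * Q ε) = η := by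
    have hPd := det_eq_one_or_of_quadratic hβ hP
    have hQd := det_eq_one_or_of_quadratic hγ (hQ 1 (Or.inl rfl))
    simp only [map_mul]
    rcases h with rfl | ⟨h1, h2, rfl⟩
    · rcases hPd.1 with h1 | h1 <;> rcases hQd.1 with h2 | h2 <;> rcases hη with rfl | rfl
      all_goals first
        | (refine ⟨1, Or.inl rfl, ?_⟩; rw [h1, h2]; ring1)
        | (refine ⟨-1, Or.inr rfl, ?_⟩; rw [hdetQ, h1, h2]; ring1)
    · exact ⟨1, Or.inl rfl, by rw [hPd.2 h1, hQd.2 h2, one_mul]⟩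
  have hεγ : ε = 1 ∨ ε = -1 := by rcases hε with rfl | rfl <;> simp [hγ]
  have hε2 : ε * ε = 1 := by rcases hεγ with rfl | rfl <;> ring
  refine ⟨P, Q ε, stdVec F _ 0, hP, hQ ε hε, fun Z h0 hZ => ?_, hdet⟩
  have hinj : Function.Injective (P * Q ε) :=
    (injective_of_quadratic one_ne_zero (left_ne_zero_of_mul_eq_one hβ2) hP).comp
      (injective_of_quadratic one_ne_zero (left_ne_zero_of_mul_eq_one hγ2) (hQ ε hε))
  refine eq_top_of_stdVec_mem fun k => ?_
  have hPk : ∀ k, P (stdVec F _ k) = dP k • stdVec F _ k + cP (k + 1) • stdVec F _ (k + 1) :=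
    bidiagonal_stdVec _ (by simp [cP])
  have hQk : ∀ k, Q ε (stdVec F _ k) = dQ ε k • stdVec F _ k + cQ (k + 1) • stdVec F _ (k + 1) :=
    bidiagonal_stdVec _ (by simp [cQ])
  induction k with
  | zero => exact h0
  | succ k ih =>
    by_cases hk : Even k
    · have hk1 : ¬ Even (k + 1) := by grind
      have hd : dQ ε k * dQ ε k = 1 := by
        by_cases hk0 : k = 0 <;> simp [dQ, hk, hk0, hε2, hγ2]
      have h1 : (P * Q ε) (stdVec F _ k) = dQ ε k • (stdVec F _ k + stdVec F _ (k + 1)) := by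
        rw [Module.End.mul_apply, hQk, map_add, map_smul, map_smul, hPk]
        simp [dP, cP, cQ, hk, hk1]
      have h2 := Z.smul_mem (dQ ε k) (hZ _ ih)
      rw [h1, smul_smul, hd, one_smul] at h2
      exact (Z.add_mem_iff_right ih).1 h2
    · have hk1 : Even (k + 1) := by grind
      have hk2 : ¬ Even (k + 1 + 1) := by grind
      have hk0 : k ≠ 0 := by grind
      have h1 : (P * Q ε) (stdVec F _ k - γ • stdVec F _ (k + 1)) = β • stdVec F _ k := by
        have h2 : Q ε (stdVec F _ k - γ • stdVec F _ (k + 1)) = stdVec F _ k := by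
          rw [map_sub, map_smul, hQk, hQk]
          simp only [dQ, cQ, hk, hk1, hk2, hk0, if_true, if_false, Nat.succ_ne_zero, zero_smul,
            add_zero, one_smul, smul_smul, hγ2]
          exact add_sub_cancel_right _ _
        rw [Module.End.mul_apply, h2, hPk]
        simp [dP, cP, hk, hk1]
      have h2 := mem_of_apply_mem_of_invariant hinj hZ (h1 ▸ Z.smul_mem β ih)
      have h3 := Z.smul_mem γ ((Z.sub_mem_iff_right ih).1 h2)
      rwa [smul_smul, hγ2, one_smul] at h3

end Bidiagonal

section Assembly

variable {F : Type*} [Field F] {V : Type*} [AddCommGroup V] [Module F V]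

theorem HasFewSimpleCells.of_finrank_sub_le_one [FiniteDimensional F V] {M : End F V}
    (h : ∀ c : F, finrank F (LinearMap.ker (M - c • 1)) -
      finrank F ↥(LinearMap.ker (M - c • 1) ⊓ LinearMap.range (M - c • 1)) ≤ 1) :
    HasFewSimpleCells M := by
  intro c x y hx hy
  by_contra! hxy
  set A := M - c • (1 : End F V) with hA
  have hmem : ∀ v, M v = c • v → v ∈ LinearMap.ker A := fun v hv => by
    simp [hA, hv]
  let K := LinearMap.ker A
  let R : Submodule F K := (LinearMap.range A).comap K.subtype
  let f : (Fin 2 → F) →ₗ[F] K ⧸ R := Fintype.linearCombination F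
    ![R.mkQ ⟨x, hmem x hx⟩, R.mkQ ⟨y, hmem y hy⟩]
  have hf : Function.Injective f := by
    refine (injective_iff_map_eq_zero f).2 fun s hs => ?_
    have h1 : R.mkQ (s 0 • ⟨x, hmem x hx⟩ + s 1 • ⟨y, hmem y hy⟩) = 0 := by
      rw [← hs, map_add, map_smul, map_smul]
      simp only [f, Fintype.linearCombination_apply, Fin.sum_univ_two]
      rfl
    rw [← LinearMap.mem_ker, Submodule.ker_mkQ] at h1
    obtain ⟨v, hv⟩ := h1
    by_contra hs0
    refine hxy (s 0) (s 1) ?_ v ?_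
    · by_contra! h0
      refine hs0 (funext fun i => ?_)
      fin_cases i
      · exact h0.1
      · exact h0.2
    · simpa [hA] using hv.symm
  have h2 := LinearMap.finrank_le_finrank_of_injective hf
  rw [finrank_fin_fun] at h2
  have h3 := R.finrank_quotient_add_finrank
  have h4 : finrank F R = finrank F ↥(K ⊓ LinearMap.range A) := by
    rw [← Submodule.map_comap_subtype]
    exact (Submodule.equivMapOfInjective _ K.subtype_injective R).finrank_eq
  have h5 := h c
  change finrank F K - finrank F ↥(K ⊓ LinearMap.range A) ≤ 1 at h5
  omega

/-- An endomorphism satisfying the hypotheses of the main theorem is a product of three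
quadratic endomorphisms with annihilating polynomials `(X - 1) (X - β)`, for prescribed signs
`β`. -/
theorem exists_eq_mul_mul_of_quadratic [FiniteDimensional F V] {M : End F V}
    (hdet : LinearMap.det M = 1 ∨ LinearMap.det M = -1) (hMc : HasFewSimpleCells M)
    (hM : ¬ ∃ (q : F[X]) (m : ℕ), Irreducible q ∧ M.charpoly = q ^ m) {β γ α : F}
    (hβ : β = 1 ∨ β = -1) (hγ : γ = 1 ∨ γ = -1) (hα : α = 1 ∨ α = -1)
    (h : γ = -1 ∨ β = 1 ∧ γ = 1 ∧ α = 1 ∧ LinearMap.det M = 1) :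
    ∃ P Q R : End F V, P * P = (1 + β) • P - β • 1 ∧ Q * Q = (1 + γ) • Q - γ • 1 ∧
      R * R = (1 + α) • R - α • 1 ∧ M = P * Q * R := by
  have hinj : Function.Injective M := by
    refine (LinearMap.equivOfDetNeZero M ?_).injective
    rcases hdet with h | h <;> rw [h] <;> simp
  have hn : finrank F V ≠ 0 := fun h0 => hM ⟨X, 0, irreducible_X, by
    rw [pow_zero, ← (LinearMap.charpoly_monic M).natDegree_eq_zero, LinearMap.charpoly_natDegree,
      h0]⟩
  obtain ⟨δ, hδ, hδ1, H⟩ := exists_quadratic_mul_similar_of_charpoly hinj hMc hM hα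
    (V' := Fin (finrank F V) → F) (by rw [finrank_fin_fun])
  obtain ⟨P, Q, v, hP, hQ, hv, hPQ⟩ := exists_quadratic_mul_quadratic_isCyclicVector hn hβ hγ
    (η := LinearMap.det M * δ)
    (by rcases hdet with h | h <;> rcases hδ with h' | h' <;> simp [h, h'])
    (h.imp_right fun ⟨h1, h2, h3, h4⟩ => ⟨h1, h2, by rw [h4, hδ1 h3, one_mul]⟩)
  obtain ⟨S, e, hS, he⟩ := H _ v hv hPQ
  have hconj : ∀ {A : End F (Fin (finrank F V) → F)} {β : F},
      (∀ v, A (A v) = (1 + β) • A v - (1 * β) • v) →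
      e.symm.conj A * e.symm.conj A = (1 + β) • e.symm.conj A - β • 1 := fun hA =>
    LinearMap.ext fun v => by
      simp [LinearEquiv.conj_apply, hA]
  let S' : End F (Fin (finrank F V) → F) := (1 + α) • 1 - α • S
  have hS' : ∀ y, S (S' y) = y := fun y => by
    simp only [S', LinearMap.sub_apply, LinearMap.smul_apply, Module.End.one_apply, map_sub,
      map_smul, hS]
    rcases hα with rfl | rfl <;> module
  refine ⟨e.symm.conj P, e.symm.conj Q, e.symm.conj S', hconj hP, hconj hQ, hconj fun v => ?_, ?_⟩
  · simp only [S', LinearMap.sub_apply, LinearMap.smul_apply, Module.End.one_apply, map_sub,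
      map_smul, hS]
    rcases hα with rfl | rfl <;> module
  · refine LinearMap.ext fun v => ?_
    have h1 := he (S' (e v))
    rw [hS', LinearEquiv.symm_apply_apply, Module.End.mul_apply] at h1
    simp [LinearEquiv.conj_apply, ← h1]

theorem Matrix.exists_eq_mul_mul_of_quadratic {n : ℕ} (M : Matrix (Fin n) (Fin n) F)
    (hdet : M.det = 1 ∨ M.det = -1)
    (hjordan : ∀ lam : F,
      finrank F (LinearMap.ker (Matrix.mulVecLin (M - lam • 1))) -
        finrank F ↥(LinearMap.ker (Matrix.mulVecLin (M - lam • 1)) ⊓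
          LinearMap.range (Matrix.mulVecLin (M - lam • 1))) ≤ 1)
    (hcp : ¬ ∃ (q : F[X]) (m : ℕ), Irreducible q ∧ M.charpoly = q ^ m) {β γ α : F}
    (hβ : β = 1 ∨ β = -1) (hγ : γ = 1 ∨ γ = -1) (hα : α = 1 ∨ α = -1)
    (h : γ = -1 ∨ β = 1 ∧ γ = 1 ∧ α = 1 ∧ M.det = 1) :
    ∃ P Q R : Matrix (Fin n) (Fin n) F, P * P = (1 + β) • P - β • 1 ∧
      Q * Q = (1 + γ) • Q - γ • 1 ∧ R * R = (1 + α) • R - α • 1 ∧ M = P * Q * R := by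
  have hsub : ∀ c : F, Matrix.toLin' M - c • 1 = Matrix.mulVecLin (M - c • 1) := fun c => by
    rw [← Matrix.toLin'_apply', map_sub, map_smul, Matrix.toLin'_one]
    rfl
  obtain ⟨P, Q, R, hP, hQ, hR, hM⟩ := _root_.exists_eq_mul_mul_of_quadratic
    (M := Matrix.toLin' M) (by rwa [LinearMap.det_toLin'])
    (HasFewSimpleCells.of_finrank_sub_le_one fun c => by rw [hsub]; exact hjordan c)
    (by rwa [Matrix.charpoly_toLin']) hβ hγ hα (by rwa [LinearMap.det_toLin'])
  have hq : ∀ {A : End F (Fin n → F)} {β : F}, A * A = (1 + β) • A - β • 1 →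
      LinearMap.toMatrix' A * LinearMap.toMatrix' A = (1 + β) • LinearMap.toMatrix' A - β • 1 :=
    fun hA => by
      rw [← LinearMap.toMatrix'_mul, hA, map_sub, map_smul, map_smul, LinearMap.toMatrix'_one]
  refine ⟨_, _, _, hq hP, hq hQ, hq hR, ?_⟩
  rw [← LinearMap.toMatrix'_mul, ← LinearMap.toMatrix'_mul, ← hM, LinearMap.toMatrix'_toLin']

theorem Matrix.sub_one_mul_sub_one_eq_zero_of_quadratic {n : ℕ} {P : Matrix (Fin n) (Fin n) F}
    (hP : P * P = (1 + (1 : F)) • P - (1 : F) • 1) : (P - 1) * (P - 1) = 0 := by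
  rw [mul_sub, sub_mul, hP, add_smul, one_smul, one_smul, mul_one, one_mul]
  abel

theorem Matrix.mul_self_eq_one_of_quadratic {n : ℕ} {P : Matrix (Fin n) (Fin n) F}
    (hP : P * P = (1 + (-1 : F)) • P - (-1 : F) • 1) : P * P = 1 := by
  simpa using hP

end Assembly

end

/-- **Decomposition of matrices with small eigenspaces (Theorem `unstabletheo3`).**
Let `F` be a field and `M ∈ GLₙ(F)` with `det M = ±1`. Assume that for every `λ ∈ F`,
the matrix `M` has at most one Jordan cell of size 1 for `λ`, i.e.
`dim ker(M − λIₙ) − dim (ker(M − λIₙ) ⊓ im(M − λIₙ)) ≤ 1`, and that the characteristic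
polynomial of `M` is not a power of an irreducible polynomial. Then for every `k ∈ {0, 1, 2}`,
the matrix `M` is a product of `k` U2-matrices and `3 − k` involutions; moreover, if
`det M = 1` then `M` is a product of three U2-matrices. -/
theorem stmt6 {F : Type*} [Field F] {n : ℕ}
    (M : Matrix (Fin n) (Fin n) F) (hM : IsUnit M)
    (hdet : M.det = 1 ∨ M.det = -1)
    (hjordan : ∀ lam : F,
      Module.finrank F (LinearMap.ker (Matrix.mulVecLin (M - lam • 1))) -
        Module.finrank F ↥(LinearMap.ker (Matrix.mulVecLin (M - lam • 1)) ⊓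
          LinearMap.range (Matrix.mulVecLin (M - lam • 1))) ≤ 1)
    (hcp : ¬ ∃ (q : Polynomial F) (m : ℕ), Irreducible q ∧ M.charpoly = q ^ m) :
    (∀ k : ℕ, k ∈ ({0, 1, 2} : Set ℕ) →
      ∃ (B : Fin 3 → Matrix (Fin n) (Fin n) F) (s : Finset (Fin 3)),
        s.card = k ∧
        (∀ j ∈ s, (B j - 1) * (B j - 1) = 0) ∧
        (∀ j ∉ s, B j * B j = 1) ∧
        M = B 0 * B 1 * B 2) ∧
    (M.det = 1 →
      ∃ U₁ U₂ U₃ : Matrix (Fin n) (Fin n) F,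
        (U₁ - 1) * (U₁ - 1) = 0 ∧ (U₂ - 1) * (U₂ - 1) = 0 ∧ (U₃ - 1) * (U₃ - 1) = 0 ∧
        M = U₁ * U₂ * U₃) := by
  refine ⟨fun k hk => ?_, fun h1 => ?_⟩
  · have key := fun {β α : F} (hβ : β = 1 ∨ β = -1) (hα : α = 1 ∨ α = -1) =>
      M.exists_eq_mul_mul_of_quadratic hdet hjordan hcp hβ (Or.inr rfl) hα (Or.inl rfl)
    rcases hk with rfl | rfl | rfl
    · obtain ⟨P, Q, R, hP, hQ, hR, hM⟩ := key (Or.inr rfl) (Or.inr rfl)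
      refine ⟨![P, Q, R], ∅, rfl, by simp, ?_, hM⟩
      simpa [Fin.forall_fin_succ] using ⟨Matrix.mul_self_eq_one_of_quadratic hP,
        Matrix.mul_self_eq_one_of_quadratic hQ, Matrix.mul_self_eq_one_of_quadratic hR⟩
    · obtain ⟨P, Q, R, hP, hQ, hR, hM⟩ := key (Or.inl rfl) (Or.inr rfl)
      refine ⟨![P, Q, R], {0}, rfl, ?_, ?_, hM⟩
      · simpa using Matrix.sub_one_mul_sub_one_eq_zero_of_quadratic hP
      · simpa [Fin.forall_fin_succ] using
          ⟨Matrix.mul_self_eq_one_of_quadratic hQ, Matrix.mul_self_eq_one_of_quadratic hR⟩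
    · obtain ⟨P, Q, R, hP, hQ, hR, hM⟩ := key (Or.inl rfl) (Or.inl rfl)
      refine ⟨![P, Q, R], {0, 2}, rfl, ?_, ?_, hM⟩
      · simpa using ⟨Matrix.sub_one_mul_sub_one_eq_zero_of_quadratic hP,
          Matrix.sub_one_mul_sub_one_eq_zero_of_quadratic hR⟩
      · simpa [Fin.forall_fin_succ] using Matrix.mul_self_eq_one_of_quadratic hQ
  · obtain ⟨P, Q, R, hP, hQ, hR, hM⟩ := M.exists_eq_mul_mul_of_quadratic hdet hjordan hcp
      (Or.inl rfl) (Or.inl rfl) (Or.inl rfl) (Or.inr ⟨rfl, rfl, rfl, h1⟩)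
    exact ⟨P, Q, R, Matrix.sub_one_mul_sub_one_eq_zero_of_quadratic hP,
      Matrix.sub_one_mul_sub_one_eq_zero_of_quadratic hQ,
      Matrix.sub_one_mul_sub_one_eq_zero_of_quadratic hR, hM⟩
end

section
/- Let F be a field of characteristic not 2 containing an element i with i² = −1. Let A ∈ GL_n(F) and let r ≥ n be an integer such that i^r · det A = 1 or i^r · det A = −1. Then the matrix A ⊕ (i I_r) ∈ GL_{n+r}(F) (block-diagonal with blocks A and i times the r×r identity) is a product of three involutions of GL_{n+r}(F). -/
/-- An element `x` of a monoid is strongly reversible if it is conjugated to its inverse by an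
involution; equivalently, `x` is a product of two involutions. -/
def StronglyReversible {M : Type*} [Monoid M] (x : M) : Prop :=
  ∃ s : M, s * s = 1 ∧ s * x * s * x = 1

section Reversible

open Polynomial

/-- If `p ^ e` divides a power of `X ^ 2 - 1`, then `F[X] ⧸ (p ^ e)` has an involutive automorphism
which inverts the class of `X`. -/
theorem exists_algHom_quotient_inverting {F : Type*} [Field F] {p : F[X]} (hp : Irreducible p)
    (e k : ℕ) (hk : (X ^ 2 - 1 : F[X]) ^ k ∈ Ideal.span {p ^ e}) :
    ∃ σ : (F[X] ⧸ Ideal.span {p ^ e}) →ₐ[F] (F[X] ⧸ Ideal.span {p ^ e}),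
      (∀ y, σ (σ y) = y) ∧
      σ (Ideal.Quotient.mk _ X) * Ideal.Quotient.mk _ X = 1 := by
  set I := Ideal.span {p ^ e} with hI
  set x : F[X] ⧸ I := Ideal.Quotient.mk I X with hx
  have hnil : (x ^ 2 - 1) ^ k = 0 := by
    rw [hx, ← map_pow, ← map_one (Ideal.Quotient.mk I), ← map_sub, ← map_pow]
    exact Ideal.Quotient.eq_zero_iff_mem.2 hk
  obtain ⟨u, hu⟩ : IsUnit x := by
    have h : IsUnit (x ^ 2) := by
      simpa using IsNilpotent.isUnit_add_one ⟨k, hnil⟩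
    exact (isUnit_pow_iff two_ne_zero).1 h
  have hux : (↑u⁻¹ : F[X] ⧸ I) * x = 1 := by rw [← hu]; simp
  have hpe : aeval (↑u⁻¹ : F[X] ⧸ I) (p ^ e) = 0 := by
    rcases Nat.eq_zero_or_pos e with rfl | he
    · have : (1 : F[X] ⧸ I) = 0 := by
        rw [← map_one (Ideal.Quotient.mk I)]
        exact Ideal.Quotient.eq_zero_iff_mem.2 (by simp [hI])
      rw [← mul_one (aeval _ _), this, mul_zero]
    · have hdvd : p ∣ (X - C 1) * (X - C (-1)) := by
        have h1 : p ∣ (X ^ 2 - 1 : F[X]) ^ k :=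
          (dvd_pow_self p he.ne').trans (Ideal.mem_span_singleton.1 hk)
        have h2 := hp.prime.dvd_of_dvd_pow h1
        convert h2 using 1
        simp only [map_one, map_neg]; ring
      obtain ⟨c, hc, hpc⟩ : ∃ c : F, c * c = 1 ∧ Associated p (X - C c) := by
        rcases hp.prime.dvd_or_dvd hdvd with h | h
        · exact ⟨1, by simp, hp.associated_of_dvd (irreducible_X_sub_C 1) h⟩
        · exact ⟨-1, by simp, hp.associated_of_dvd (irreducible_X_sub_C (-1)) h⟩
      have hxc : (x - algebraMap F _ c) ^ e = 0 := by
        have : (X - C c) ^ e ∈ I := Ideal.mem_span_singleton.2 (hpc.pow_pow (n := e)).dvd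
        have := Ideal.Quotient.eq_zero_iff_mem.2 this
        rwa [map_pow, map_sub] at this
      obtain ⟨w, hw⟩ := hpc.symm
      rw [← hw]
      have hcc : algebraMap F (F[X] ⧸ I) c * algebraMap F (F[X] ⧸ I) c = 1 := by
        rw [← map_mul, hc, map_one]
      have : (↑u⁻¹ : F[X] ⧸ I) - algebraMap F _ c
          = -(algebraMap F _ c * ↑u⁻¹) * (x - algebraMap F _ c) := by
        linear_combination (algebraMap F (F[X] ⧸ I) c) * hux - (↑u⁻¹ : F[X] ⧸ I) * hcc
      rw [map_pow, map_mul, map_sub, aeval_X, aeval_C, mul_pow, this, mul_pow, hxc]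
      simp
  refine ⟨Ideal.Quotient.liftₐ I (aeval (↑u⁻¹ : F[X] ⧸ I)) ?_, ?_, ?_⟩
  · intro a ha
    obtain ⟨b, rfl⟩ := Ideal.mem_span_singleton.1 ha
    rw [map_mul, hpe, zero_mul]
  · set σ := Ideal.Quotient.liftₐ I (aeval (↑u⁻¹ : F[X] ⧸ I)) _
    have hσx : σ x = ↑u⁻¹ := (Ideal.Quotient.lift_mk I _ _).trans (aeval_X _)
    have hσu : σ ↑u⁻¹ = x := by
      have h1 : σ ↑u⁻¹ * ↑u⁻¹ = 1 := by
        rw [← hσx, ← map_mul, hσx, hux, map_one]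
      calc σ ↑u⁻¹ = (σ ↑u⁻¹ * ↑u⁻¹) * x := by rw [mul_assoc, hux, mul_one]
        _ = x := by rw [h1, one_mul]
    have : (σ.comp σ).comp (Ideal.Quotient.mkₐ F I) = Ideal.Quotient.mkₐ F I := by
      apply Polynomial.algHom_ext
      change σ (σ x) = x
      rw [hσx, hσu]
    intro y
    obtain ⟨y, rfl⟩ := Ideal.Quotient.mk_surjective y
    exact congrArg (fun g => g y) this
  · exact (congrArg (· * x) ((Ideal.Quotient.lift_mk I _ _).trans (aeval_X _))).trans hux

open DirectSum in
/-- If `f² - 1` is nilpotent, then `f` is strongly reversible. -/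
theorem stronglyReversible_of_isNilpotent {F V : Type*} [Field F] [AddCommGroup V] [Module F V]
    [FiniteDimensional F V] (f : Module.End F V) (hf : IsNilpotent (f ^ 2 - 1)) :
    StronglyReversible f := by
  obtain ⟨k, hk⟩ := hf
  have hkill : ∀ m : Module.AEval' f, ((X ^ 2 - 1 : F[X]) ^ k) • m = 0 := by
    intro m
    apply (Module.AEval'.of f).symm.injective
    rw [Module.AEval.of_symm_smul]
    simp [hk]
  have hne : (X ^ 2 - 1 : F[X]) ^ k ≠ 0 := pow_ne_zero _ (X_pow_sub_C_ne_zero two_pos 1)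
  have htors : Module.IsTorsion F[X] (Module.AEval' f) := fun {m} =>
    ⟨⟨_, mem_nonZeroDivisors_of_ne_zero hne⟩, hkill m⟩
  obtain ⟨ι, _, p, hp, e, ⟨E⟩⟩ := Module.equiv_directSum_of_isTorsion htors
  classical
  have hmem : ∀ j, (X ^ 2 - 1 : F[X]) ^ k ∈ Ideal.span {p j ^ e j} := by
    intro j
    have h := congrArg E (hkill (E.symm (DirectSum.of (fun j => F[X] ⧸ F[X] ∙ p j ^ e j) j
      (Ideal.Quotient.mk _ 1))))
    rw [map_smul, E.apply_symm_apply, map_zero] at h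
    have h2 := congrArg (fun z => z j) h
    simp only [DirectSum.smul_apply, DirectSum.of_eq_same, DirectSum.zero_apply] at h2
    rw [← Ideal.Quotient.eq_zero_iff_mem, ← mul_one ((X ^ 2 - 1 : F[X]) ^ k)]
    exact h2
  choose σ hσ hσx using fun j => exists_algHom_quotient_inverting (hp j) (e j) k (hmem j)
  let S : (⨁ j, F[X] ⧸ F[X] ∙ p j ^ e j) →ₗ[F] (⨁ j, F[X] ⧸ F[X] ∙ p j ^ e j) :=
    DirectSum.lmap fun j => (σ j).toLinearMap
  have hS : ∀ z, S (S z) = z := fun z => by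
    refine DFinsupp.ext fun j => ?_
    exact hσ j _
  have hSX : ∀ z, S ((X : F[X]) • S ((X : F[X]) • z)) = z := fun z => by
    refine DFinsupp.ext fun j => ?_
    change σ j (Ideal.Quotient.mk _ X * σ j (Ideal.Quotient.mk _ X * z j)) = z j
    rw [map_mul, hσ, ← mul_assoc, hσx, one_mul]
  let E' : V ≃ₗ[F] (⨁ j, F[X] ⧸ F[X] ∙ p j ^ e j) :=
    (Module.AEval'.of f).trans (E.restrictScalars F)
  have hE : ∀ v, E' (f v) = (X : F[X]) • E' v := fun v => by
    change E (Module.AEval'.of f (f v)) = X • E (Module.AEval'.of f v)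
    rw [← map_smul, Module.AEval'.X_smul_of]
  refine ⟨E'.symm.toLinearMap ∘ₗ S ∘ₗ E'.toLinearMap, ?_, ?_⟩
  · ext v
    simp [hS]
  · ext v
    simp [hSX, hE]

end Reversible

section Factorization

variable {F V : Type*} [Field F] [AddCommGroup V] [Module F V]

/-- A functional `φ` with `φ v = 1` splits `V` as the direct sum of `ker φ` and the line of `v`. -/
def splitKer (φ : V →ₗ[F] F) (v : V) (hv : φ v = 1) : V ≃ₗ[F] LinearMap.ker φ × F where
  toFun w := (⟨w - φ w • v, by simp [hv]⟩, φ w)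
  invFun p := p.1 + p.2 • v
  map_add' x y := by ext <;> simp [add_smul]; abel
  map_smul' c x := by ext <;> simp [mul_smul, smul_sub]
  left_inv w := by simp
  right_inv p := by
    obtain ⟨⟨h, hh⟩, a⟩ := p
    rw [LinearMap.mem_ker] at hh
    ext <;> simp [hh, hv]

theorem finrank_ker_of_apply_eq_one [FiniteDimensional F V] (φ : V →ₗ[F] F) (v : V)
    (hv : φ v = 1) : Module.finrank F (LinearMap.ker φ) + 1 = Module.finrank F V := by
  rw [(splitKer φ v hv).finrank_eq]
  simp

theorem exists_dual_apply_eq_one_apply_eq_one {v w : V} (h : LinearIndependent F ![v, w]) :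
    ∃ φ : V →ₗ[F] F, φ v = 1 ∧ φ w = 1 := by
  rw [LinearIndependent.pair_iff] at h
  have h1 : v ∉ Submodule.span F {w} := fun hm => by
    obtain ⟨a, ha⟩ := Submodule.mem_span_singleton.1 hm
    simpa using (h 1 (-a) (by simp [ha])).1
  have h2 : w ∉ Submodule.span F {v} := fun hm => by
    obtain ⟨a, ha⟩ := Submodule.mem_span_singleton.1 hm
    simpa using (h (-a) 1 (by simp [ha])).2
  obtain ⟨f, hf, hfw⟩ := Submodule.exists_le_ker_of_notMem h1
  obtain ⟨g, hg, hgv⟩ := Submodule.exists_le_ker_of_notMem h2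
  have hfw' : f w = 0 := hfw (Submodule.mem_span_singleton_self w)
  have hgv' : g v = 0 := hgv (Submodule.mem_span_singleton_self v)
  exact ⟨(f v)⁻¹ • f + (g w)⁻¹ • g, by simp [hgv', hf], by simp [hfw', hg]⟩

/-- One can choose a functional normalised at `v` and `B v` for which the Schur complement of `B`
along the corresponding decomposition of `V` is not scalar. -/
theorem exists_dual_schur_complement_not_scalar [FiniteDimensional F V] (B : Module.End F V)
    (hB : Function.Injective B) {v : V} (hv : LinearIndependent F ![v, B v]) :
    ∃ φ : V →ₗ[F] F, φ v = 1 ∧ φ (B v) = 1 ∧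
      (Module.finrank F V = 2 ∨ ∀ c : F, ∃ h, φ h = 0 ∧ B h - φ (B h) • B v ≠ c • h) := by
  obtain ⟨φ, hφv, hφw⟩ := exists_dual_apply_eq_one_apply_eq_one hv
  by_contra! hcon
  obtain ⟨hdim, c, hc⟩ := hcon φ hφv hφw
  have hlt : Submodule.span F (Set.range ![v, B v]) < ⊤ := by
    refine lt_top_iff_ne_top.2 fun htop => hdim ?_
    rw [← finrank_top, ← htop, finrank_span_eq_card hv, Fintype.card_fin]
  obtain ⟨η, hη, hle⟩ := Submodule.exists_le_ker_of_lt_top _ hlt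
  have hηv : η v = 0 := hle (Submodule.subset_span ⟨0, rfl⟩)
  have hηw : η (B v) = 0 := hle (Submodule.subset_span ⟨1, rfl⟩)
  obtain ⟨-, d, hd⟩ := hcon (φ + η) (by simp [hφv, hηv]) (by simp [hφw, hηw])
  obtain ⟨z, hz⟩ : ∃ z, η z = 1 := by
    obtain ⟨z, hz⟩ := DFunLike.ne_iff.1 hη
    exact ⟨(η z)⁻¹ • z, by simpa using inv_mul_cancel₀ hz⟩
  have hind := LinearIndependent.pair_iff.1 hv
  set w := B v with hw
  have e1 := hc (v - w) (by simp [hφv, hφw])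
  have e2 := hd (v - w) (by simp [hφv, hφw, hηv, hηw])
  have hcd : c = d := by
    have := (hind (c - d) (d - c + φ (B (v - w)) - (φ + η) (B (v - w))) (by
      linear_combination (norm := module) e2 - e1)).1
    exact sub_eq_zero.1 this
  subst hcd
  have e3 := hc (z - φ z • v) (by simp [hφv])
  have e4 := hd (z - φ z • v - v) (by simp [hφv, hηv, hz])
  have hc0 : c = 0 := by
    refine (hind c (φ (B (z - φ z • v)) - (φ + η) (B (z - φ z • v - v)) - 1) ?_).1
    have e5 : B (z - φ z • v - v) = B (z - φ z • v) - w := by rw [map_sub]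
    rw [e5] at e4 ⊢
    linear_combination (norm := module) e4 - e3
  subst hc0
  have e6 : v - w = φ (B (v - w)) • v := by
    apply hB
    rw [map_smul, ← hw]
    linear_combination (norm := module) e1
  have := (hind (1 - φ (B (v - w))) (-1) (by linear_combination (norm := module) e6)).2
  simp at this

theorem LinearMap.pow_apply_eq_zero_of_forall {N : Module.End F V} {p : V → Prop} {k : ℕ}
    (hp : ∀ x, p (N x)) (hk : ∀ x, p x → (N ^ k) x = 0) : N ^ (k + 1) = 0 := by
  ext x
  rw [pow_succ]
  exact hk _ (hp x)

/-- Every invertible nonscalar endomorphism is the product of a unipotent endomorphism and of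
an endomorphism which stabilises a hyperplane and is unipotent on it. -/
theorem exists_unipotent_mul (n : ℕ) : ∀ {V : Type*} [AddCommGroup V] [Module F V]
    [FiniteDimensional F V] (B : Module.End F V), Function.Injective B →
    Module.finrank F V = n + 1 →
    (n = 0 ∨ ∀ c : F, ∃ h, B h ≠ c • h) →
    ∃ (P U : Module.End F V) (ψ : V →ₗ[F] F) (δ : F), B = P * U ∧ IsNilpotent (P - 1) ∧ ψ ≠ 0 ∧
      (∀ x, ψ (U x) = δ * ψ x) ∧ ∃ k : ℕ, ∀ x, ψ x = 0 → ((U - 1) ^ k) x = 0 := by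
  induction n with
  | zero =>
    intro V _ _ _ B _ hn _
    let e : V ≃ₗ[F] F := LinearEquiv.ofFinrankEq V F (by simpa using hn)
    refine ⟨1, B, e.toLinearMap, e (B (e.symm 1)), (one_mul B).symm, by simp, ?_, fun x => ?_, 0,
      fun x hx => ?_⟩
    · intro h
      simpa using congrArg (fun g => g (e.symm 1)) h
    · have : x = e x • e.symm 1 := by rw [← map_smul]; simp
      conv_lhs => rw [this]
      simp [mul_comm]
    · simpa using hx
  | succ n ih =>
    intro V _ _ _ B hB hn hns
    replace hns := hns.resolve_left n.succ_ne_zero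
    obtain ⟨v, hv⟩ : ∃ v, LinearIndependent F ![v, B v] := by
      by_contra! h
      obtain ⟨a, ha⟩ := B.exists_eq_smul_id_of_forall_notLinearIndependent h
      obtain ⟨x, hx⟩ := hns a
      exact hx (by simp [ha])
    obtain ⟨φ, hφv, hφw, hφ⟩ := exists_dual_schur_complement_not_scalar B hB hv
    let H := LinearMap.ker φ
    have hH : Module.finrank F H = n + 1 := by
      have := finrank_ker_of_apply_eq_one φ v hφv
      change Module.finrank F (LinearMap.ker φ) = n + 1
      omega
    have hmem : ∀ h : H, φ h = 0 := fun h => h.2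
    let π : V →ₗ[F] H := LinearMap.fst F H F ∘ₗ (splitKer φ v hφv).toLinearMap
    have hπ : ∀ w, (π w : V) = w - φ w • v := fun w => rfl
    have hπH : ∀ h : H, π h = h := fun h => Subtype.ext (by simp [hπ, hmem])
    have hπv : π v = 0 := Subtype.ext (by simp [hπ, hφv])
    let D : Module.End F H :=
      LinearMap.codRestrict H (B ∘ₗ H.subtype - (φ ∘ₗ B ∘ₗ H.subtype).smulRight (B v))
        fun h => by simp [H, hφw]
    have hD : ∀ h : H, (D h : V) = B h - φ (B h) • B v := fun h => rfl
    have hDinj : Function.Injective D := by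
      rw [← LinearMap.ker_eq_bot, LinearMap.ker_eq_bot']
      intro h hh
      have h1 : B h = B (φ (B h) • v) := by
        rw [map_smul, ← sub_eq_zero, ← hD, hh]; rfl
      have h2 := hB h1
      have h3 : φ (B h) = 0 := by simpa [hφv, hmem] using (congrArg φ h2).symm
      rw [h3, zero_smul] at h2
      exact Subtype.ext h2
    obtain ⟨P, U, ψ, δ, hPU, ⟨k, hk⟩, hψ, hψU, l, hl⟩ := ih D hDinj hH (by
      rcases hφ with h2 | h
      · left; omega
      · right
        intro c
        obtain ⟨h, hh, hne⟩ := h c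
        exact ⟨⟨h, hh⟩, fun h' => hne (congrArg Subtype.val h')⟩)
    let P' : Module.End F V := φ.smulRight (B v) + H.subtype ∘ₗ P ∘ₗ π
    let U' : Module.End F V :=
      (φ + φ ∘ₗ B ∘ₗ H.subtype ∘ₗ π).smulRight v + H.subtype ∘ₗ U ∘ₗ π
    have hP' : ∀ w, P' w = φ w • B v + P (π w) := fun w => rfl
    have hU' : ∀ w, U' w = (φ w + φ (B (π w))) • v + U (π w) := fun w => rfl
    refine ⟨P', U', ψ ∘ₗ π, δ, ?_, ⟨k + 1, ?_⟩, ?_, ?_, l + 1, ?_⟩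
    · ext w
      have h1 : φ (U' w) = φ w + φ (B (π w)) := by simp [hU', hφv, hmem]
      have h2 : π (U' w) = U (π w) := by
        rw [hU', map_add, map_smul, hπv, hπH, smul_zero, zero_add]
      have h3 : P (U (π w)) = D (π w) := by rw [hPU]; rfl
      rw [Module.End.mul_apply, hP', h1, h2, h3, hD]
      have h4 : B (π w) = B w - φ w • B v := by rw [hπ, map_sub, map_smul]
      linear_combination (norm := module) -h4
    · refine LinearMap.pow_apply_eq_zero_of_forall (p := fun x => φ x = 0) (fun x => ?_)
        (fun x hx => ?_)
      · simp [hP', hφw, hmem]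
      · have : ∀ (m : ℕ) (h : H), ((P' - 1) ^ m) (h : V) = (((P - 1) ^ m) h : H) := by
          intro m
          induction m with
          | zero => simp
          | succ m ihm =>
            intro h
            rw [pow_succ, pow_succ, Module.End.mul_apply, Module.End.mul_apply, ← ihm]
            congr 1
            simp [hP', hπH, hmem]
        rw [this k ⟨x, hx⟩, hk]; rfl
    · intro h
      refine hψ (LinearMap.ext fun x => ?_)
      simpa [hπH] using congrArg (fun g => g (x : V)) h
    · intro x
      simp only [LinearMap.comp_apply]
      rw [hU', map_add, map_smul, hπv, hπH, smul_zero, zero_add, hψU]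
    · intro x hx
      have : ∀ m : ℕ, π (((U' - 1) ^ m) x) = ((U - 1) ^ m) (π x) := by
        intro m
        induction m with
        | zero => simp
        | succ m ihm =>
          rw [pow_succ', pow_succ', Module.End.mul_apply, Module.End.mul_apply, ← ihm]
          rw [LinearMap.sub_apply, hU', map_sub, map_add, map_smul, hπv, hπH]
          simp
      have h0 : π (((U' - 1) ^ l) x) = 0 := by rw [this, hl _ hx]
      rw [pow_succ', Module.End.mul_apply]
      set y := ((U' - 1) ^ l) x
      have hy : y = φ y • v := by
        rw [← sub_eq_zero, ← hπ, h0]; rfl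
      rw [LinearMap.sub_apply, hU', h0]
      simp [← hy]

theorem LinearMap.det_eq_one_of_isNilpotent_sub_one [FiniteDimensional F V] {P : Module.End F V}
    (hP : IsNilpotent (P - 1)) : LinearMap.det P = 1 := by
  have h := LinearMap.eval_charpoly (1 - P) 1
  have h2 : IsNilpotent (1 - P) := by rw [← neg_sub]; exact hP.neg
  rw [h2.charpoly_eq_X_pow_finrank] at h
  simpa using h.symm

theorem LinearMap.det_eq_of_dual_eigenvector [FiniteDimensional F V] {U : Module.End F V}
    {ψ : V →ₗ[F] F} {δ : F} (hψ : ψ ≠ 0) (hU : ∀ x, ψ (U x) = δ * ψ x) {k : ℕ}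
    (hk : ∀ x, ψ x = 0 → ((U - 1) ^ k) x = 0) : LinearMap.det U = δ := by
  have he : ∀ x ∈ LinearMap.ker ψ, U x ∈ LinearMap.ker ψ := fun x hx => by
    simp [hU, LinearMap.mem_ker.1 hx]
  rw [LinearMap.det_eq_det_mul_det _ U he, LinearMap.det_eq_one_of_isNilpotent_sub_one, one_mul]
  · have : (LinearMap.ker ψ).mapQ (LinearMap.ker ψ) U he = δ • 1 := by
      apply Submodule.linearMap_qext
      ext x
      simp only [LinearMap.comp_apply, Submodule.mkQ_apply, Submodule.mapQ_apply,
        LinearMap.smul_apply, Module.End.one_apply]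
      rw [← Submodule.Quotient.mk_smul, Submodule.Quotient.eq]
      simp [hU]
    rw [this, LinearMap.det_smul, map_one, mul_one, ψ.quotKerEquivRange.finrank_eq,
      LinearMap.range_eq_top.2 (LinearMap.surjective hψ)]
    simp
  · refine ⟨k, LinearMap.ext fun x => Subtype.ext ?_⟩
    have : ∀ (m : ℕ) (x : LinearMap.ker ψ),
        ((((LinearMap.restrict U he : Module.End F (LinearMap.ker ψ)) - 1) ^ m) x : V)
          = ((U - 1) ^ m) (x : V) := by
      intro m
      induction m with
      | zero => simp
      | succ m ihm =>
        intro x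
        rw [pow_succ, pow_succ, Module.End.mul_apply, Module.End.mul_apply, ihm]
        simp
    rw [this, hk _ x.2]; rfl

/-- Every invertible nonscalar endomorphism `B` is the product of an endomorphism which stabilises
a hyperplane, is unipotent on it and has determinant `det B`, and of a unipotent endomorphism. -/
theorem exists_mul_unipotent [FiniteDimensional F V] (B : Module.End F V)
    (hB : Function.Injective B) (hns : ∀ c : F, B ≠ c • 1) :
    ∃ (U P : Module.End F V) (ψ : V →ₗ[F] F), B = U * P ∧ IsNilpotent (P - 1) ∧ ψ ≠ 0 ∧
      (∀ x, ψ (U x) = LinearMap.det B * ψ x) ∧ ∃ k : ℕ, ∀ x, ψ x = 0 → ((U - 1) ^ k) x = 0 := by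
  have hpos : 0 < Module.finrank F V := by
    by_contra! h
    have := Module.finrank_zero_iff.1 (Nat.le_zero.1 h)
    exact hns 0 (LinearMap.ext fun x => Subsingleton.elim _ _)
  obtain ⟨n, hn⟩ := Nat.exists_eq_succ_of_ne_zero hpos.ne'
  obtain ⟨P, U, ψ, δ, hPU, hP, hψ, hU, k, hk⟩ := exists_unipotent_mul n B hB hn
    (Or.inr fun c => by
      by_contra! h
      exact hns c (LinearMap.ext h))
  have hdet : LinearMap.det B = δ := by
    rw [hPU, map_mul, LinearMap.det_eq_one_of_isNilpotent_sub_one hP, one_mul,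
      LinearMap.det_eq_of_dual_eigenvector hψ hU hk]
  have hUinj : Function.Injective U := by
    intro x y h
    apply hB
    rw [hPU, Module.End.mul_apply, Module.End.mul_apply, h]
  let u := U.linearEquivOfInjective hUinj rfl
  have hu : ∀ x, u x = U x := fun x => rfl
  have h1 : U * u.symm.toLinearMap = 1 := LinearMap.ext fun x => by simp [← hu]
  have h2 : u.symm.toLinearMap * U = 1 := LinearMap.ext fun x => by simp [← hu]
  refine ⟨U, u.symm.toLinearMap * P * U, ψ, ?_, ?_, hψ, by rwa [hdet], k, hk⟩
  · rw [hPU, mul_assoc, ← mul_assoc U, h1, one_mul]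
  · obtain ⟨l, hl⟩ := hP
    refine ⟨l, ?_⟩
    have : ∀ m : ℕ,
        (u.symm.toLinearMap * P * U - 1) ^ m = u.symm.toLinearMap * (P - 1) ^ m * U := by
      intro m
      induction m with
      | zero => simp [h2]
      | succ m ih =>
        rw [pow_succ, ih, pow_succ]
        have : u.symm.toLinearMap * P * U - 1 = u.symm.toLinearMap * (P - 1) * U := by
          rw [mul_sub, sub_mul, mul_one, h2]
        rw [this]
        calc _ = u.symm.toLinearMap * (P - 1) ^ m * (U * u.symm.toLinearMap) * (P - 1) * U := by
              simp only [mul_assoc]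
          _ = _ := by rw [h1]; simp only [mul_assoc, mul_one]
    rw [this, hl, mul_zero, zero_mul]

end Factorization

section Similarity

variable {F V W : Type*} [Field F] [AddCommGroup V] [Module F V] [AddCommGroup W] [Module F W]

theorem StronglyReversible.of_semiconj (e : V ≃ₗ[F] W) {f : Module.End F V} {g : Module.End F W}
    (h : ∀ v, e (f v) = g (e v)) (hg : StronglyReversible g) : StronglyReversible f := by
  obtain ⟨s, hs, hx⟩ := hg
  have hs' : ∀ w, s (s w) = w := fun w => congrArg (fun q => q w) hs
  have hx' : ∀ w, s (g (s (g w))) = w := fun w => congrArg (fun q => q w) hx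
  refine ⟨e.symm.toLinearMap ∘ₗ s ∘ₗ e.toLinearMap, ?_, ?_⟩
  · ext v
    simp [hs']
  · ext v
    simp [hx', h]

theorem StronglyReversible.prodMap {f : Module.End F V} {g : Module.End F W}
    (hf : StronglyReversible f) (hg : StronglyReversible g) :
    StronglyReversible (M := Module.End F (V × W)) (f.prodMap g) := by
  obtain ⟨s, hs, hx⟩ := hf
  obtain ⟨t, ht, hy⟩ := hg
  refine ⟨s.prodMap t, ?_, ?_⟩
  · rw [LinearMap.prodMap_mul, hs, ht, LinearMap.prodMap_one]
  · simp only [LinearMap.prodMap_mul, hx, hy, LinearMap.prodMap_one]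

theorem stronglyReversible_prodMap_smul {c d : F} (h : c * d = 1) :
    StronglyReversible (M := Module.End F (V × V))
      ((c • 1 : Module.End F V).prodMap (d • 1 : Module.End F V)) := by
  have h' : d * c = 1 := by rw [mul_comm, h]
  refine ⟨(LinearEquiv.prodComm F V V).toLinearMap, ?_, ?_⟩
  · ext <;> simp
  · ext <;> simp [smul_smul, h, h']

/-- An endomorphism is, up to similarity, determined by `g ∘ U` if it is a scalar plus `U ∘ g`
with `U` injective and `g` surjective. -/
theorem exists_linearEquiv_comp_eq {E : Type*} [AddCommGroup E] [Module F E]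
    [FiniteDimensional F E] [FiniteDimensional F V] [FiniteDimensional F W]
    {U : E →ₗ[F] V} {U' : E →ₗ[F] W} {g : V →ₗ[F] E} {g' : W →ₗ[F] E}
    (hU : Function.Injective U) (hU' : Function.Injective U') (hg : Function.Surjective g)
    (hg' : Function.Surjective g') (hcomp : ∀ e, g (U e) = g' (U' e))
    (hdim : Module.finrank F V = Module.finrank F W) :
    ∃ T : V ≃ₗ[F] W, (∀ e, T (U e) = U' e) ∧ ∀ v, g' (T v) = g v := by
  obtain ⟨s, hs⟩ := g.exists_rightInverse_of_surjective (LinearMap.range_eq_top.2 hg)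
  obtain ⟨s', hs'⟩ := g'.exists_rightInverse_of_surjective (LinearMap.range_eq_top.2 hg')
  have hs : ∀ e, g (s e) = e := fun e => congrArg (fun q => q e) hs
  have hs' : ∀ e, g' (s' e) = e := fun e => congrArg (fun q => q e) hs'
  let κ : V →ₗ[F] LinearMap.ker g :=
    LinearMap.codRestrict _ (LinearMap.id - s ∘ₗ g) fun v => by simp [hs]
  let κ' : W →ₗ[F] LinearMap.ker g' :=
    LinearMap.codRestrict _ (LinearMap.id - s' ∘ₗ g') fun v => by simp [hs']
  have hκ : ∀ v, (κ v : V) = v - s (g v) := fun v => rfl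
  have hκ' : ∀ v, (κ' v : W) = v - s' (g' v) := fun v => rfl
  let G : E →ₗ[F] E := g ∘ₗ U
  have hG : ∀ e, G e = g (U e) := fun e => rfl
  let u : LinearMap.ker G →ₗ[F] LinearMap.ker g := κ ∘ₗ U ∘ₗ (LinearMap.ker G).subtype
  let u' : LinearMap.ker G →ₗ[F] LinearMap.ker g' := κ' ∘ₗ U' ∘ₗ (LinearMap.ker G).subtype
  have hGe : ∀ e : LinearMap.ker G, g (U e) = 0 := fun e => e.2
  have hu : Function.Injective u := fun a b hab => by
    have := congrArg Subtype.val hab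
    simp only [u, LinearMap.comp_apply, hκ, Submodule.subtype_apply, hGe, map_zero,
      sub_zero] at this
    exact Subtype.ext (hU this)
  have hu' : Function.Injective u' := fun a b hab => by
    have := congrArg Subtype.val hab
    simp only [u', LinearMap.comp_apply, hκ', Submodule.subtype_apply, ← hcomp, hGe, map_zero,
      sub_zero] at this
    exact Subtype.ext (hU' this)
  have hker : Module.finrank F (LinearMap.ker g) = Module.finrank F (LinearMap.ker g') := by
    have h1 := g.finrank_range_add_finrank_ker
    have h2 := g'.finrank_range_add_finrank_ker
    rw [LinearMap.range_eq_top.2 hg] at h1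
    rw [LinearMap.range_eq_top.2 hg'] at h2
    omega
  obtain ⟨τ, hτ⟩ : ∃ τ : LinearMap.ker g ≃ₗ[F] LinearMap.ker g', ∀ e, τ (u e) = u' e := by
    obtain ⟨q, hq⟩ := (LinearMap.range u).exists_isCompl
    obtain ⟨q', hq'⟩ := (LinearMap.range u').exists_isCompl
    let er := (LinearEquiv.ofInjective u hu).symm.trans (LinearEquiv.ofInjective u' hu')
    have h1 := Submodule.finrank_add_eq_of_isCompl hq
    have h2 := Submodule.finrank_add_eq_of_isCompl hq'
    have h3 := er.finrank_eq
    let eq : q ≃ₗ[F] q' := LinearEquiv.ofFinrankEq q q' (by omega)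
    refine ⟨(Submodule.prodEquivOfIsCompl _ _ hq).symm.trans
      ((er.prodCongr eq).trans (Submodule.prodEquivOfIsCompl _ _ hq')), fun e => ?_⟩
    have h4 : (Submodule.prodEquivOfIsCompl _ _ hq).symm (u e)
        = (LinearEquiv.ofInjective u hu e, 0) := by
      rw [LinearEquiv.symm_apply_eq]
      simp
    simp [h4, er]
  let h : E →ₗ[F] LinearMap.ker g := τ.symm.toLinearMap ∘ₗ κ' ∘ₗ U' - κ ∘ₗ U
  obtain ⟨φ, hφ⟩ : ∃ φ : E →ₗ[F] LinearMap.ker g, ∀ e, φ (G e) = h e := by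
    have hle : LinearMap.ker G ≤ LinearMap.ker h := fun e he => by
      have h1 : τ.symm (u' ⟨e, he⟩) = u ⟨e, he⟩ := by rw [← hτ, τ.symm_apply_apply]
      change τ.symm (κ' (U' e)) - κ (U e) = 0
      exact sub_eq_zero.2 h1
    obtain ⟨φ, hφ⟩ := LinearMap.exists_extend
      ((LinearMap.ker G).liftQ h hle ∘ₗ G.quotKerEquivRange.symm.toLinearMap)
    refine ⟨φ, fun e => ?_⟩
    have h1 := congrArg (fun q => q ⟨G e, LinearMap.mem_range_self G e⟩) hφ
    simpa using h1
  let T : V →ₗ[F] W :=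
    (LinearMap.ker g').subtype ∘ₗ τ.toLinearMap ∘ₗ (κ + φ ∘ₗ g) + s' ∘ₗ g
  have hT : ∀ v, T v = τ (κ v + φ (g v)) + s' (g v) := fun v => rfl
  have hgT : ∀ v, g' (T v) = g v := fun v => by
    have : g' (τ (κ v + φ (g v))) = 0 := (τ (κ v + φ (g v))).2
    rw [hT, map_add, this, zero_add, hs']
  have hinj : Function.Injective T := by
    rw [← LinearMap.ker_eq_bot, LinearMap.ker_eq_bot']
    intro v hv
    have h1 : g v = 0 := by rw [← hgT, hv, map_zero]
    rw [hT, h1, map_zero, map_zero, add_zero, add_zero] at hv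
    have h2 : κ v = 0 := by
      apply τ.injective
      rw [map_zero]
      exact Subtype.ext hv
    have h3 := hκ v
    rw [h2, h1, map_zero, sub_zero] at h3
    exact h3.symm
  refine ⟨T.linearEquivOfInjective hinj hdim, fun e => ?_, hgT⟩
  rw [LinearMap.linearEquivOfInjective_apply, hT, ← hG, hφ]
  have h1 : κ (U e) + h e = τ.symm (κ' (U' e)) := by simp [h]
  rw [h1, τ.apply_symm_apply, hκ', hG, hcomp]
  abel

end Similarity

section Companion

variable {F R V : Type*} [Field F] [AddCommGroup R] [Module F R] [AddCommGroup V] [Module F V]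

/-- The block companion endomorphism of the quadratic polynomial `X² - C X - B`. -/
def blockCompanion (C B : Module.End F R) : Module.End F (R × R) :=
  (C.coprod B).prod (LinearMap.fst F R R)

theorem blockCompanion_apply (C B : Module.End F R) (p : R × R) :
    blockCompanion C B p = (C p.1 + B p.2, p.1) := rfl

/-- Let `R` be the range of `f - i`, and let `B` be the restriction of `i f` to `R`. Multiplying
`f` by a suitable involution yields a block companion endomorphism with constant term `B` and
essentially arbitrary linear term `C`. -/
theorem exists_three_involutions_of_blockCompanion [FiniteDimensional F V] [FiniteDimensional F R]
    {i : F} (hi : i ^ 2 = -1) (f : Module.End F V) {j : R →ₗ[F] V} {g : V →ₗ[F] R}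
    (hj : Function.Injective j) (hg : Function.Surjective g) (hf : ∀ v, f v = i • v + j (g v))
    {Z : Type*} [AddCommGroup Z] [Module F Z] [FiniteDimensional F Z] {C B : Module.End F R}
    (hB : ∀ x, j (B x) = i • f (j x))
    (hsurj : ∀ z, ∃ x y, C x + (B y + y) = z) (J : Module.End F Z) (hJ : J * J = 1)
    (hdim : Module.finrank F V = 2 * Module.finrank F R + Module.finrank F Z)
    (hrev : StronglyReversible (M := Module.End F ((R × R) × Z))
      ((blockCompanion C B).prodMap (i • J))) :
    ∃ S₁ S₂ S₃ : Module.End F V, S₁ * S₁ = 1 ∧ S₂ * S₂ = 1 ∧ S₃ * S₃ = 1 ∧ f = S₁ * S₂ * S₃ := by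
  have hii : i * i = -1 := by rw [← hi, sq]
  have hJ' : ∀ z, J (J z) = z := fun z => congrArg (fun q => q z) hJ
  let S : Module.End F ((R × R) × Z) :=
    ((i • LinearMap.snd F R R).prod (-i • LinearMap.fst F R R)).prodMap J
  have hSa : ∀ p, S p = ((i • p.1.2, -i • p.1.1), J p.2) := fun p => rfl
  have hS : ∀ p, S (S p) = p := fun p => by
    obtain ⟨⟨a, b⟩, z⟩ := p
    simp [hSa, hJ', smul_smul, hii]
  set N : Module.End F ((R × R) × Z) := (blockCompanion C B).prodMap (i • J) with hN
  have hNa : ∀ p, N p = ((C p.1.1 + B p.1.2, p.1.1), i • J p.2) := fun p => rfl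
  let U : R →ₗ[F] (R × R) × Z := LinearMap.inl F (R × R) Z ∘ₗ LinearMap.inr F R R
  have hU : ∀ x, U x = ((0, x), 0) := fun x => rfl
  let g' : (R × R) × Z →ₗ[F] R := (-i • C.coprod (B + 1)) ∘ₗ LinearMap.fst F (R × R) Z
  have hg' : ∀ p, g' p = -i • (C p.1.1 + (B p.1.2 + p.1.2)) := fun p => rfl
  obtain ⟨T, hTU, hTg⟩ := exists_linearEquiv_comp_eq (U := j) (U' := U) (g := g) (g' := g')
    hj (fun a b h => by simpa [hU] using h) hg
    (fun z => by
      obtain ⟨x, y, hxy⟩ := hsurj (i • z)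
      exact ⟨((x, y), 0), by rw [hg', hxy, smul_smul, neg_mul, hii, neg_neg, one_smul]⟩)
    (fun e => by
      apply hj
      have h1 := hf (j e)
      have h2 := hB e
      simp only [hg', hU, map_zero, zero_add, map_smul, map_add, h2, smul_add, smul_smul, neg_mul,
        hii]
      linear_combination (norm := module) -h1)
    (by rw [hdim, Module.finrank_prod, Module.finrank_prod, two_mul])
  have hTf : ∀ v, T (f v) = S (N (T v)) := fun v => by
    rw [hf, map_add, map_smul, hTU (g v), ← hTg]
    obtain ⟨⟨a, b⟩, z⟩ := T v
    simp only [hU, hg', hSa, hNa, map_smul, hJ', Prod.smul_mk, Prod.mk_add_mk, add_zero]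
    congr 2
    module
  obtain ⟨s, hs, hx⟩ := hrev
  have hs' : ∀ w, s (s w) = w := fun w => congrArg (fun q => q w) hs
  have hx' : ∀ w, s (N (s (N w))) = w := fun w => congrArg (fun q => q w) hx
  refine ⟨T.symm.toLinearMap ∘ₗ S ∘ₗ T.toLinearMap, T.symm.toLinearMap ∘ₗ s ∘ₗ T.toLinearMap,
    T.symm.toLinearMap ∘ₗ (s * N) ∘ₗ T.toLinearMap, ?_, ?_, ?_, ?_⟩
  · ext v; simp [hS]
  · ext v; simp [hs']
  · ext v; simp [hx']
  · ext v
    apply T.injective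
    simp [hs', hTf]

end Companion

section Factored

variable {F R : Type*} [Field F] [AddCommGroup R] [Module F R]

/-- If `U² - 1` and `P² - 1` are nilpotent on the relevant vectors, so is `N² - 1` for the block
companion `N` of `(X - U) (X + P)`. -/
theorem blockCompanion_factored_pow_apply (U P : Module.End F R) {k l : ℕ}
    (hP : (P * P - 1) ^ l = 0) {x y : R} (hx : ((U * U - 1) ^ k) (x + P y) = 0) :
    ((blockCompanion (U - P) (U * P) * blockCompanion (U - P) (U * P) - 1) ^ (l + k)) (x, y)
      = 0 := by
  set N := blockCompanion (U - P) (U * P)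
  have hN : ∀ p, N p = (U p.1 - P p.1 + U (P p.2), p.1) := fun p => rfl
  have h1 : ∀ (m : ℕ) (p : R × R), (((N * N - 1) ^ m) p).1 + P (((N * N - 1) ^ m) p).2
      = ((U * U - 1) ^ m) (p.1 + P p.2) := by
    intro m
    induction m with
    | zero => simp
    | succ m ih =>
      intro p
      rw [pow_succ, Module.End.mul_apply, ih, pow_succ, Module.End.mul_apply]
      congr 1
      simp [hN]
      abel
  have h2 : ∀ (m : ℕ) (y : R), ((N * N - 1) ^ m) (-P y, y)
      = (-P (((P * P - 1) ^ m) y), ((P * P - 1) ^ m) y) := by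
    intro m
    induction m with
    | zero => simp
    | succ m ih =>
      intro y
      have : (N * N - 1) (-P y, y) = (-P ((P * P - 1) y), (P * P - 1) y) := by
        simp [hN]
        abel
      rw [pow_succ, Module.End.mul_apply, this, ih, pow_succ, Module.End.mul_apply]
  rw [pow_add, Module.End.mul_apply]
  have h3 := h1 k (x, y)
  rw [hx] at h3
  have h4 : ((N * N - 1) ^ k) (x, y)
      = (-P (((N * N - 1) ^ k) (x, y)).2, (((N * N - 1) ^ k) (x, y)).2) :=
    Prod.ext (eq_neg_of_add_eq_zero_left h3) rfl
  rw [h4, h2, hP]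
  simp

theorem isNilpotent_mul_self_sub_one {A : Type*} [Ring A] {P : A} (hP : IsNilpotent (P - 1)) :
    IsNilpotent (P * P - 1) := by
  have h : P * P - 1 = (P - 1) * (P + 1) := by noncomm_ring
  rw [h]
  exact Commute.isNilpotent_mul_right (by simp [commute_iff_eq]; noncomm_ring) hP

theorem exists_factored_eq (h2 : (2 : F) ≠ 0) (U P : Module.End F R) (hP : IsNilpotent (P - 1))
    (z : R) : ∃ x y, (U - P) x + ((U * P) y + y) = z := by
  have hu : IsUnit (P * P + 1) := by
    have h3 : IsUnit (algebraMap F (Module.End F R) 2) := (IsUnit.mk0 _ h2).map _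
    have h4 : P * P + 1 = algebraMap F (Module.End F R) 2 + (P * P - 1) := by
      rw [map_ofNat, ← one_add_one_eq_two]; abel
    rw [h4]
    exact (isNilpotent_mul_self_sub_one hP).isUnit_add_left_of_commute h3
      (Algebra.commutes _ _).symm
  obtain ⟨Q, hQ⟩ := hu.exists_right_inv
  have hz : P (P (Q z)) + Q z = z := congrArg (fun q => q z) hQ
  refine ⟨-P (Q z), Q z, ?_⟩
  simp only [LinearMap.sub_apply, Module.End.mul_apply, map_neg]
  linear_combination (norm := module) hz

/-- An endomorphism `N` with an eigenvalue `q` of multiplicity one such that `q² = -1`, and whose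
other eigenvalues are `±1`, becomes strongly reversible after adding the eigenvalue `-q`. -/
theorem stronglyReversible_prodMap_of_dual_eigenvector [FiniteDimensional F R]
    (h2 : (2 : F) ≠ 0) {N : Module.End F R} {Ψ : R →ₗ[F] F} (hΨ : Ψ ≠ 0) {q : F} (hq : q ^ 2 = -1)
    (hN : ∀ x, Ψ (N x) = q * Ψ x) {k : ℕ} (hk : ∀ x, Ψ x = 0 → ((N * N - 1) ^ k) x = 0) :
    StronglyReversible (M := Module.End F (R × F)) (N.prodMap (-q • 1 : Module.End F F)) := by
  obtain ⟨w, hw⟩ := LinearMap.surjective hΨ 1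
  have hpow : ∀ m : ℕ, Ψ (((N * N - 1) ^ m) w) = (-2) ^ m := by
    intro m
    induction m with
    | zero => simpa using hw
    | succ m ih =>
      rw [pow_succ', Module.End.mul_apply, LinearMap.sub_apply, map_sub, Module.End.mul_apply,
        hN, hN, Module.End.one_apply, ih]
      linear_combination (-2) ^ m * hq
  obtain ⟨v, hv, hNv⟩ : ∃ v, Ψ v = 1 ∧ N v = q • v := by
    refine ⟨((-2) ^ k : F)⁻¹ • ((N * N - 1) ^ k) w, ?_, ?_⟩
    · rw [map_smul, hpow, smul_eq_mul, inv_mul_cancel₀ (pow_ne_zero _ (neg_ne_zero.2 h2))]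
    · have h1 := hk (N w - q • w) (by rw [map_sub, hN, map_smul, smul_eq_mul, sub_self])
      have h3 : Commute N ((N * N - 1) ^ k) :=
        (((Commute.refl N).mul_right (Commute.refl N)).sub_right (Commute.one_right N)).pow_right k
      rw [map_sub, map_smul, ← Module.End.mul_apply, ← h3.eq, Module.End.mul_apply,
        sub_eq_zero] at h1
      rw [map_smul, h1, smul_comm]
  have hres : ∀ x ∈ LinearMap.ker Ψ, N x ∈ LinearMap.ker Ψ := fun x hx => by
    simp [hN, LinearMap.mem_ker.1 hx]
  let N' : Module.End F (LinearMap.ker Ψ) := N.restrict hres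
  have hN' : ∀ x : LinearMap.ker Ψ, (N' x : R) = N x := fun x => rfl
  have hrev : StronglyReversible N' := by
    apply stronglyReversible_of_isNilpotent
    rw [sq]
    refine ⟨k, LinearMap.ext fun x => Subtype.ext ?_⟩
    have : ∀ (m : ℕ) (x : LinearMap.ker Ψ),
        (((N' * N' - 1) ^ m) x : R) = ((N * N - 1) ^ m) (x : R) := by
      intro m
      induction m with
      | zero => simp
      | succ m ih =>
        intro x
        rw [pow_succ, pow_succ, Module.End.mul_apply, Module.End.mul_apply, ih]
        simp [hN']
    rw [this, hk _ x.2]; rfl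
  refine StronglyReversible.of_semiconj
    (((splitKer Ψ v hv).prodCongr (LinearEquiv.refl F F)).trans (LinearEquiv.prodAssoc F _ _ _))
    ?_ (hrev.prodMap (stronglyReversible_prodMap_smul (V := F) (c := q) (d := -q)
      (by linear_combination -hq)))
  rintro ⟨x, a⟩
  have h3 : ∀ x, splitKer Ψ v hv (N x)
      = (N' (splitKer Ψ v hv x).1, q * (splitKer Ψ v hv x).2) := fun x => by
    refine Prod.ext (Subtype.ext ?_) (hN x)
    change N x - Ψ (N x) • v = N (x - Ψ x • v)
    rw [hN, map_sub, map_smul, hNv, smul_smul, mul_comm]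
  simp [h3]

end Factored

section Diagonal

variable {F : Type*} [Field F]

theorem stronglyReversible_mulLeft_of_involutive {ι : Type*} {d : ι → F} {σ : ι → ι}
    (hσ : ∀ j, σ (σ j) = j) (hd : ∀ j, d (σ j) * d j = 1) :
    StronglyReversible (M := Module.End F (ι → F)) (LinearMap.mulLeft F d) := by
  refine ⟨LinearMap.funLeft F F σ, ?_, ?_⟩
  · refine LinearMap.ext fun f => funext fun j => ?_
    change f (σ (σ j)) = f j
    rw [hσ]
  · refine LinearMap.ext fun f => funext fun j => ?_
    change d (σ j) * (d (σ (σ j)) * f (σ (σ j))) = f j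
    rw [hσ, ← mul_assoc, hd, one_mul]

/-- The block companion of the commuting family `(X - x j) (X - y j)` is diagonalisable when
`x j ≠ y j` for all `j`. -/
theorem exists_linearEquiv_blockCompanion_mulLeft {ι : Type*} [Fintype ι] {x y : ι → F} {b : F}
    (hxy : ∀ j, x j ≠ y j) (hb : ∀ j, x j * y j = -b) :
    ∃ e : ((ι → F) × (ι → F)) ≃ₗ[F] (ι ⊕ ι → F), ∀ p,
      e (blockCompanion (LinearMap.mulLeft F (x + y)) (b • 1) p)
        = LinearMap.mulLeft F (Sum.elim x y) (e p) := by
  let E : ((ι → F) × (ι → F)) →ₗ[F] (ι ⊕ ι → F) :=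
    { toFun p := Sum.elim (p.1 - y * p.2) (p.1 - x * p.2)
      map_add' p q := by
        ext (j | j) <;> simp <;> ring
      map_smul' a p := by
        ext (j | j) <;> simp <;> ring }
  have hE : ∀ p, E p = Sum.elim (p.1 - y * p.2) (p.1 - x * p.2) := fun p => rfl
  have hinj : Function.Injective E := by
    rw [← LinearMap.ker_eq_bot, LinearMap.ker_eq_bot']
    rintro ⟨u, w⟩ h
    have h1 : ∀ j, u j - y j * w j = 0 := fun j => congrFun h (Sum.inl j)
    have h2 : ∀ j, u j - x j * w j = 0 := fun j => congrFun h (Sum.inr j)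
    have hw : w = 0 := funext fun j => by
      have h3 : (x j - y j) * w j = 0 := by linear_combination h1 j - h2 j
      exact (mul_eq_zero.1 h3).resolve_left (sub_ne_zero.2 (hxy j))
    have hu : u = 0 := funext fun j => by simpa [hw] using h1 j
    rw [hu, hw]; rfl
  refine ⟨E.linearEquivOfInjective hinj (by simp), fun p => ?_⟩
  rw [LinearMap.linearEquivOfInjective_apply, LinearMap.linearEquivOfInjective_apply, hE, hE]
  ext (j | j)
  · simp [blockCompanion_apply]
    linear_combination p.2 j * hb j
  · simp [blockCompanion_apply]
    linear_combination p.2 j * hb j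

/-- A family together with an extra value, as a family indexed by `Option ι`. -/
def prodOptionEquiv (F ι : Type*) [Field F] : ((ι → F) × F) ≃ₗ[F] (Option ι → F) where
  toFun p o := o.elim p.2 p.1
  invFun f := (fun j => f (some j), f none)
  map_add' p q := by ext (_ | j) <;> rfl
  map_smul' a p := by ext (_ | j) <;> rfl
  left_inv p := rfl
  right_inv f := by ext (_ | j) <;> rfl

theorem exists_stronglyReversible_blockCompanion_scalar {i : F} (h2 : (2 : F) ≠ 0)
    (hi : i ^ 2 = -1) {n : ℕ} {b : F} (hb : b ^ (2 * (n + 1)) = 1) (hb2 : b ^ 2 ≠ 1) :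
    ∃ C : Module.End F (Fin (n + 1) → F), StronglyReversible (blockCompanion C (b • 1)) := by
  obtain ⟨c, rfl⟩ : ∃ c, b = -c := ⟨-b, by simp⟩
  replace hb : c ^ (n + 1) * c ^ (n + 1) = 1 := by
    rw [← pow_add, ← two_mul, ← hb, (even_two_mul _).neg_pow]
  have hc : c ≠ 0 := by rintro rfl; simp at hb
  have hi0 : i ≠ 0 := by rintro rfl; simp at hi
  by_cases hodd : ∃ j : ℕ, c ^ (2 * j + 1) = 1
  · obtain ⟨j₀, hj₀⟩ := hodd
    have hcn : c ^ (n + 1) = 1 := by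
      have h1 : (c ^ (n + 1)) ^ (2 * j₀ + 1) = 1 := by
        rw [← pow_mul, mul_comm, pow_mul, hj₀, one_pow]
      rwa [pow_succ, pow_mul, sq, hb, one_pow, one_mul] at h1
    let x : Fin (n + 1) → F := fun j => i * c⁻¹ ^ (j : ℕ)
    let y : Fin (n + 1) → F := fun j => i⁻¹ * c ^ ((j : ℕ) + 1)
    have hxy : ∀ j, x j ≠ y j := fun j h => by
      have h1 : c ^ (2 * (j : ℕ) + 1) = -1 := by
        simp only [x, y, inv_pow] at h
        field_simp at h
        rw [← hi, h, ← pow_add]; congr 1; omega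
      have h3 : (c ^ (2 * (j : ℕ) + 1)) ^ (2 * j₀ + 1) = 1 := by
        rw [← pow_mul, mul_comm, pow_mul, hj₀, one_pow]
      rw [h1, (odd_two_mul_add_one j₀).neg_one_pow] at h3
      exact h2 (by linear_combination -h3)
    have hprod : ∀ j, x j * y j = -(-c) := fun j => by
      simp only [x, y, inv_pow, pow_succ]
      field_simp
    obtain ⟨e, he⟩ := exists_linearEquiv_blockCompanion_mulLeft hxy hprod
    refine ⟨_, StronglyReversible.of_semiconj e he
      (stronglyReversible_mulLeft_of_involutive (σ := Sum.elim
        (Fin.cases (Sum.inr (Fin.last n)) fun k => Sum.inr k.castSucc)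
        (Fin.lastCases (Sum.inl 0) fun k => Sum.inl k.succ)) ?_ ?_)⟩
    · rintro (j | j)
      · refine Fin.cases ?_ (fun k => ?_) j <;> simp
      · refine Fin.lastCases ?_ (fun k => ?_) j <;> simp
    · rintro (j | j)
      · refine Fin.cases ?_ (fun k => ?_) j
        · simp [x, y, hcn, hi0]
        · simp [x, y]; field_simp
      · refine Fin.lastCases ?_ (fun k => ?_) j
        · simp [x, y, hcn, hi0]
        · simp [x, y]; field_simp
  · push Not at hodd
    let x : Fin (n + 1) → F := fun j => c⁻¹ ^ (j : ℕ)
    let y : Fin (n + 1) → F := fun j => c ^ ((j : ℕ) + 1)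
    have hxy : ∀ j, x j ≠ y j := fun j h => by
      refine hodd j ?_
      simp only [x, y, inv_pow] at h
      field_simp at h
      rw [h, ← pow_add]; congr 1; omega
    have hprod : ∀ j, x j * y j = -(-c) := fun j => by
      simp only [x, y, inv_pow, pow_succ]
      field_simp
    obtain ⟨e, he⟩ := exists_linearEquiv_blockCompanion_mulLeft hxy hprod
    refine ⟨_, StronglyReversible.of_semiconj e he
      (stronglyReversible_mulLeft_of_involutive (σ := Sum.elim
        (Fin.cases (Sum.inl 0) fun k => Sum.inr k.castSucc)
        (Fin.lastCases (Sum.inr (Fin.last n)) fun k => Sum.inl k.succ)) ?_ ?_)⟩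
    · rintro (j | j)
      · refine Fin.cases ?_ (fun k => ?_) j <;> simp
      · refine Fin.lastCases ?_ (fun k => ?_) j <;> simp
    · rintro (j | j)
      · refine Fin.cases ?_ (fun k => ?_) j
        · simp [x]
        · simp [x, y]; field_simp
      · refine Fin.lastCases ?_ (fun k => ?_) j
        · simp [y, hb]
        · simp [x, y]; field_simp

theorem exists_stronglyReversible_blockCompanion_scalar_prodMap {i : F} (h2 : (2 : F) ≠ 0)
    (hi : i ^ 2 = -1) {n : ℕ} {b : F} (hb : b ^ (2 * (n + 1)) = -1) :
    ∃ C : Module.End F (Fin (n + 1) → F),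
      StronglyReversible (M := Module.End F (_ × F))
        ((blockCompanion C (b • 1)).prodMap (-i • 1 : Module.End F F)) := by
  obtain ⟨c, rfl⟩ : ∃ c, b = -c := ⟨-b, by simp⟩
  replace hb : c ^ (n + 1) * c ^ (n + 1) = -1 := by
    rw [← pow_add, ← two_mul, ← hb, (even_two_mul _).neg_pow]
  have hc : c ≠ 0 := by rintro rfl; simp at hb
  have hi0 : i ≠ 0 := by rintro rfl; simp at hi
  let x : Fin (n + 1) → F := fun j => i * c⁻¹ ^ (j : ℕ)
  let y : Fin (n + 1) → F := fun j => i⁻¹ * c ^ ((j : ℕ) + 1)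
  have hxy : ∀ j, x j ≠ y j := fun j h => by
    have h1 : c ^ (2 * (j : ℕ) + 1) = -1 := by
      simp only [x, y, inv_pow] at h
      field_simp at h
      rw [← hi, h, ← pow_add]; congr 1; omega
    have h3 : (c ^ (n + 1) * c ^ (n + 1)) ^ (2 * (j : ℕ) + 1) = 1 := by
      calc _ = ((c ^ (2 * (j : ℕ) + 1)) ^ 2) ^ (n + 1) := by ring
        _ = 1 := by rw [h1, neg_one_sq, one_pow]
    rw [hb, (odd_two_mul_add_one _).neg_one_pow] at h3
    exact h2 (by linear_combination -h3)
  have hprod : ∀ j, x j * y j = -(-c) := fun j => by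
    simp only [x, y, inv_pow, pow_succ]
    field_simp
  obtain ⟨e, he⟩ := exists_linearEquiv_blockCompanion_mulLeft hxy hprod
  have he' : ∀ p, prodOptionEquiv F _ ((LinearMap.mulLeft F (Sum.elim x y)).prodMap
      (-i • 1 : Module.End F F) p)
      = LinearMap.mulLeft F (fun o => o.elim (-i) (Sum.elim x y)) (prodOptionEquiv F _ p) := by
    intro p
    ext (_ | j) <;> rfl
  refine ⟨LinearMap.mulLeft F (x + y), StronglyReversible.of_semiconj
    ((e.prodCongr (LinearEquiv.refl F F)).trans (prodOptionEquiv F _)) (fun p => ?_)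
    (stronglyReversible_mulLeft_of_involutive (d := fun o => o.elim (-i) (Sum.elim x y))
      (σ := fun o => o.elim (some (Sum.inl 0)) (Sum.elim
        (Fin.cases none fun k => some (Sum.inr k.castSucc))
        (Fin.lastCases (some (Sum.inr (Fin.last n))) fun k => some (Sum.inl k.succ)))) ?_ ?_)⟩
  · rw [LinearEquiv.trans_apply, LinearEquiv.trans_apply, ← he']
    congr 1
    exact Prod.ext (he p.1) rfl
  · rintro (_ | j | j)
    · simp
    · refine Fin.cases ?_ (fun k => ?_) j <;> simp
    · refine Fin.lastCases ?_ (fun k => ?_) j <;> simp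
  · rintro (_ | j | j)
    · simp [x]
      linear_combination -hi
    · refine Fin.cases ?_ (fun k => ?_) j
      · simp [x]
        linear_combination -hi
      · simp [x, y]; field_simp
    · refine Fin.lastCases ?_ (fun k => ?_) j
      · simp [y]; field_simp
        linear_combination hb - hi
      · simp [x, y]; field_simp

end Diagonal

section Existence

variable {F : Type*} [Field F]

theorem exists_blockCompanion_scalar_eq {R : Type*} [AddCommGroup R] [Module F R] {b : F}
    (hb : b ≠ -1) (z : R) :
    ∃ y : R, (b • 1 : Module.End F R) y + y = z := by
  have hb' : b + 1 ≠ 0 := fun h => hb (eq_neg_of_add_eq_zero_left h)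
  refine ⟨(b + 1)⁻¹ • z, ?_⟩
  rw [LinearMap.smul_apply, Module.End.one_apply]
  nth_rewrite 2 [← one_smul F ((b + 1)⁻¹ • z)]
  rw [← add_smul, smul_smul, mul_inv_cancel₀ hb', one_smul]

theorem LinearMap.det_smul_one_pi {ρ : ℕ} (b : F) :
    LinearMap.det (b • 1 : Module.End F (Fin ρ → F)) = b ^ ρ := by
  rw [LinearMap.det_smul, map_one, mul_one, Module.finrank_fin_fun]

theorem mul_self_sub_one_pow_apply {R : Type*} [AddCommGroup R] [Module F R] {U : Module.End F R}
    {k : ℕ} {x : R} (hx : ((U - 1) ^ k) x = 0) : ((U * U - 1) ^ k) x = 0 := by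
  have h : U * U - 1 = (U + 1) * (U - 1) := by noncomm_ring
  rw [h, Commute.mul_pow (by simp [commute_iff_eq]; noncomm_ring), Module.End.mul_apply, hx,
    map_zero]

/-- If `det B ^ 2 = 1`, then some block companion with constant term `B` is strongly reversible. -/
theorem exists_stronglyReversible_blockCompanion {i : F} (h2 : (2 : F) ≠ 0) (hi : i ^ 2 = -1)
    {ρ : ℕ} {B : Module.End F (Fin ρ → F)} (hB : Function.Injective B)
    (hdet : LinearMap.det B ^ 2 = 1) :
    ∃ C : Module.End F (Fin ρ → F), (∀ z, ∃ x y, C x + (B y + y) = z) ∧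
      StronglyReversible (blockCompanion C B) := by
  have factored : ∀ U P : Module.End F (Fin ρ → F), IsNilpotent (U * U - 1) →
      IsNilpotent (P - 1) → ∃ C : Module.End F (Fin ρ → F),
      (∀ z, ∃ x y, C x + ((U * P) y + y) = z) ∧ StronglyReversible (blockCompanion C (U * P)) := by
    rintro U P ⟨k, hU⟩ hP
    refine ⟨U - P, exists_factored_eq h2 U P hP, stronglyReversible_of_isNilpotent _ ?_⟩
    obtain ⟨l, hl⟩ := isNilpotent_mul_self_sub_one hP
    rw [sq]
    refine ⟨l + k, LinearMap.ext fun p => blockCompanion_factored_pow_apply U P hl ?_⟩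
    rw [hU, LinearMap.zero_apply]
  by_cases hns : ∃ c : F, B = c • 1
  · obtain ⟨b, rfl⟩ := hns
    rcases ρ with _ | n
    · obtain ⟨C, hC⟩ := factored 1 1 (by simp) (by simp)
      rw [Subsingleton.elim (b • 1) (1 * 1 : Module.End F (Fin 0 → F))]
      exact ⟨C, hC⟩
    · by_cases hb : b ^ 2 = 1
      · obtain ⟨C, hC⟩ := factored (b • 1) 1
          (by rw [smul_mul_smul_comm, ← sq, hb]; simp) (by simp)
        rw [mul_one] at hC
        exact ⟨C, hC⟩
      · rw [LinearMap.det_smul_one_pi, ← pow_mul, mul_comm] at hdet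
        obtain ⟨C, hC⟩ := exists_stronglyReversible_blockCompanion_scalar h2 hi hdet hb
        refine ⟨C, fun z => ?_, hC⟩
        obtain ⟨y, hy⟩ := exists_blockCompanion_scalar_eq (b := b)
          (fun h => hb (by rw [h, neg_one_sq])) z
        exact ⟨0, y, by rw [map_zero, zero_add, hy]⟩
  · push Not at hns
    obtain ⟨U, P, ψ, rfl, hP, -, hψU, k, hk⟩ := exists_mul_unipotent B hB hns
    refine factored U P ⟨k + 1, LinearMap.pow_apply_eq_zero_of_forall
      (p := fun x => ψ x = 0) (fun x => ?_) fun x hx => mul_self_sub_one_pow_apply (hk x hx)⟩ hP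
    rw [LinearMap.sub_apply, map_sub, Module.End.mul_apply, hψU, hψU, ← mul_assoc, ← sq, hdet,
      Module.End.one_apply, one_mul, sub_self]

/-- If `det B ^ 2 = -1`, then some block companion with constant term `B` becomes strongly
reversible after adding a primitive fourth root of unity as an eigenvalue. -/
theorem exists_stronglyReversible_blockCompanion_prodMap {i : F} (h2 : (2 : F) ≠ 0)
    (hi : i ^ 2 = -1) {ρ : ℕ} {B : Module.End F (Fin ρ → F)} (hB : Function.Injective B)
    (hdet : LinearMap.det B ^ 2 = -1) :
    ∃ (C : Module.End F (Fin ρ → F)) (q : F), (∀ z, ∃ x y, C x + (B y + y) = z) ∧ q ^ 2 = -1 ∧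
      StronglyReversible (M := Module.End F (_ × F))
        ((blockCompanion C B).prodMap (-q • 1 : Module.End F F)) := by
  by_cases hns : ∃ c : F, B = c • 1
  · obtain ⟨b, rfl⟩ := hns
    rw [LinearMap.det_smul_one_pi, ← pow_mul, mul_comm] at hdet
    have hneg : (1 : F) ≠ -1 := fun h => h2 (by linear_combination h)
    rcases ρ with _ | n
    · simp at hdet
      exact (hneg hdet).elim
    · obtain ⟨C, hC⟩ := exists_stronglyReversible_blockCompanion_scalar_prodMap h2 hi hdet
      refine ⟨C, i, fun z => ?_, hi, hC⟩
      obtain ⟨y, hy⟩ := exists_blockCompanion_scalar_eq (b := b)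
        (fun h => hneg (by rw [← hdet, h, (even_two_mul _).neg_one_pow])) z
      exact ⟨0, y, by rw [map_zero, zero_add, hy]⟩
  · push Not at hns
    obtain ⟨U, P, ψ, hUP, hP, hψ, hψU, k, hk⟩ := exists_mul_unipotent B hB hns
    refine ⟨U - P, LinearMap.det B, hUP ▸ exists_factored_eq h2 U P hP, hdet, ?_⟩
    obtain ⟨l, hl⟩ := isNilpotent_mul_self_sub_one hP
    have hN : ∀ p, blockCompanion (U - P) B p = (U p.1 - P p.1 + U (P p.2), p.1) := by
      rw [hUP]; exact fun p => rfl
    let Ψ : ((Fin ρ → F) × (Fin ρ → F)) →ₗ[F] F := ψ.coprod (ψ ∘ₗ P)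
    have hΨ : ∀ p, Ψ p = ψ (p.1 + P p.2) := fun p => (map_add ψ _ _).symm
    refine stronglyReversible_prodMap_of_dual_eigenvector h2 (Ψ := Ψ) (k := l + k) ?_ hdet ?_ ?_
    · intro h
      refine hψ (LinearMap.ext fun x => ?_)
      simpa [hΨ] using congrArg (fun g => g (x, 0)) h
    · intro p
      rw [hΨ, hΨ, hN, ← hψU]
      congr 1
      rw [map_add, add_right_comm, sub_add_cancel]
    · rintro ⟨x, y⟩ hxy
      rw [hUP]
      exact blockCompanion_factored_pow_apply U P hl
        (mul_self_sub_one_pow_apply (hk _ (by rwa [hΨ] at hxy)))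

end Existence

section Main

variable {F : Type*} [Field F]

theorem LinearMap.det_one_add_comp_comm {m n : ℕ} (A : (Fin n → F) →ₗ[F] (Fin m → F))
    (B : (Fin m → F) →ₗ[F] (Fin n → F)) :
    LinearMap.det (1 + A ∘ₗ B : Module.End F (Fin m → F))
      = LinearMap.det (1 + B ∘ₗ A : Module.End F (Fin n → F)) := by
  rw [← LinearMap.det_toMatrix', ← LinearMap.det_toMatrix', map_add, map_add,
    LinearMap.toMatrix'_comp, LinearMap.toMatrix'_comp, LinearMap.toMatrix'_one,
    LinearMap.toMatrix'_one, Matrix.det_one_add_mul_comm]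

/-- If `f - i` has rank at most half the dimension and `det f ^ 2 = 1`, then `f` is a product of
three involutions. -/
theorem exists_three_involutions {i : F} (h2 : (2 : F) ≠ 0) (hi : i ^ 2 = -1) {m : ℕ}
    (f : Module.End F (Fin m → F)) (hdet : LinearMap.det f ^ 2 = 1)
    (hrank : 2 * Module.finrank F (LinearMap.range (f - i • 1)) ≤ m) :
    ∃ S₁ S₂ S₃ : Module.End F (Fin m → F),
      S₁ * S₁ = 1 ∧ S₂ * S₂ = 1 ∧ S₃ * S₃ = 1 ∧ f = S₁ * S₂ * S₃ := by
  have hii : i * i = -1 := by rw [← hi, sq]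
  have hi0 : i ≠ 0 := by rintro rfl; simp at hi
  obtain ⟨ρ, hρ⟩ : ∃ ρ, ρ = Module.finrank F (LinearMap.range (f - i • 1)) := ⟨_, rfl⟩
  rw [← hρ] at hrank
  let e : LinearMap.range (f - i • 1) ≃ₗ[F] (Fin ρ → F) :=
    LinearEquiv.ofFinrankEq _ _ (by simp [hρ])
  let j : (Fin ρ → F) →ₗ[F] (Fin m → F) :=
    (LinearMap.range (f - i • 1)).subtype ∘ₗ e.symm.toLinearMap
  let g : (Fin m → F) →ₗ[F] (Fin ρ → F) := e.toLinearMap ∘ₗ (f - i • 1).rangeRestrict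
  have hj : Function.Injective j := (Submodule.injective_subtype _).comp e.symm.injective
  have hg : Function.Surjective g := e.surjective.comp (LinearMap.surjective_rangeRestrict _)
  have hf : ∀ v, f v = i • v + j (g v) := fun v => by
    change f v = i • v + (e.symm (e ((f - i • 1).rangeRestrict v)) : Fin m → F)
    rw [e.symm_apply_apply]
    change f v = i • v + (f v - i • v)
    abel
  let B : Module.End F (Fin ρ → F) := -1 + i • (g ∘ₗ j)
  have hB : ∀ x, j (B x) = i • f (j x) := fun x => by
    have h : B x = -x + i • g (j x) := rfl
    rw [h, hf, map_add, map_neg, map_smul]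
    linear_combination (norm := module) -hii • j x
  have hfinj : Function.Injective f := by
    rw [← LinearMap.ker_eq_bot]
    by_contra h
    have h0 := LinearMap.det_eq_zero_iff_ker_ne_bot.2 h
    simp [h0] at hdet
  have hBinj : Function.Injective B := fun x y h => by
    have h1 := congrArg j h
    rw [hB, hB] at h1
    exact hj (hfinj (smul_right_injective _ hi0 h1))
  have hBdet : (-1 : F) ^ m * LinearMap.det B ^ 2 = 1 := by
    have h1 : f = i • (1 + (-i • j) ∘ₗ g) := LinearMap.ext fun v => by
      have h : (i • (1 + (-i • j) ∘ₗ g) : Module.End F (Fin m → F)) v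
        = i • (v + -i • j (g v)) := rfl
      rw [hf, h]
      linear_combination (norm := module) hii • j (g v)
    have h3 : B = (-1 : F) • (1 + g ∘ₗ (-i • j)) := LinearMap.ext fun v => by
      have h : ((-1 : F) • (1 + g ∘ₗ (-i • j)) : Module.End F (Fin ρ → F)) v
        = (-1 : F) • (v + g (-i • j v)) := rfl
      have h' : B v = -v + i • g (j v) := rfl
      rw [h, h', map_smul]
      module
    rw [h3, LinearMap.det_smul, ← LinearMap.det_one_add_comp_comm, mul_pow, ← pow_mul, mul_comm _ 2,
      pow_mul, neg_one_sq, one_pow, one_mul, ← hi, ← hdet]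
    rw [h1, LinearMap.det_smul, Module.finrank_fin_fun, mul_pow]
    ring
  obtain ⟨k, hk | hk⟩ := Nat.even_or_odd' (m - 2 * ρ)
  · have hm : m = 2 * (ρ + k) := by omega
    rw [hm, (even_two_mul _).neg_one_pow, one_mul] at hBdet
    obtain ⟨C, hC, hrev⟩ := exists_stronglyReversible_blockCompanion h2 hi hBinj hBdet
    refine exists_three_involutions_of_blockCompanion hi f hj hg hf (Z := (Fin k → F) × (Fin k → F))
      hB hC (LinearMap.prodMap 1 (-1)) ?_ ?_ ?_
    · refine LinearMap.ext fun p => ?_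
      simp
    · simp; omega
    · refine StronglyReversible.of_semiconj (LinearEquiv.refl F _) (fun p => ?_)
        (hrev.prodMap (stronglyReversible_prodMap_smul (V := Fin k → F) (c := i) (d := -i)
          (by rw [mul_neg, hii, neg_neg])))
      exact Prod.ext rfl (Prod.ext rfl ((smul_neg i p.2.2).trans (neg_smul i p.2.2).symm))
  · have hm : m = 2 * (ρ + k) + 1 := by omega
    rw [hm, (odd_two_mul_add_one _).neg_one_pow, neg_one_mul, neg_eq_iff_eq_neg] at hBdet
    obtain ⟨C, q, hC, hq, hrev⟩ :=
      exists_stronglyReversible_blockCompanion_prodMap h2 hi hBinj hBdet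
    refine exists_three_involutions_of_blockCompanion hi f hj hg hf
      (Z := F × (Fin k → F) × (Fin k → F))
      hB hC (LinearMap.prodMap ((i * q) • 1) (LinearMap.prodMap 1 (-1))) ?_ ?_ ?_
    · have h : i * q * (i * q) = 1 := by linear_combination q ^ 2 * hii - hq
      refine LinearMap.ext fun p => ?_
      simp [← mul_assoc, h]
    · simp; omega
    · refine StronglyReversible.of_semiconj (LinearEquiv.prodAssoc F _ _ _).symm (fun p => ?_)
        (hrev.prodMap (stronglyReversible_prodMap_smul (V := Fin k → F) (c := i) (d := -i)
          (by rw [mul_neg, hii, neg_neg])))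
      refine Prod.ext (Prod.ext rfl ?_)
        (Prod.ext rfl ((smul_neg i p.2.2.2).trans (neg_smul i p.2.2.2).symm))
      change i * (i * q * p.2.1) = -q * p.2.1
      linear_combination q * p.2.1 * hii

end Main

theorem Matrix.rank_fromBlocks_zero_le {F : Type*} [Field F] {n r : ℕ}
    (A : Matrix (Fin n) (Fin n) F) :
    (Matrix.fromBlocks A 0 0 (0 : Matrix (Fin r) (Fin r) F)).rank ≤ n := by
  have h : Matrix.fromBlocks A 0 0 (0 : Matrix (Fin r) (Fin r) F)
      = Matrix.fromRows A (0 : Matrix (Fin r) (Fin n) F)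
        * Matrix.fromCols (1 : Matrix (Fin n) (Fin n) F) (0 : Matrix (Fin n) (Fin r) F) := by
    rw [Matrix.fromRows_mul_fromCols]
    simp
  rw [h]
  exact (Matrix.rank_mul_le_left _ _).trans ((Matrix.rank_le_card_width _).trans (by simp))

/-- **Unnatural extensions, three involutions (Theorem `skew3involutions`).**
Let `F` be a field of characteristic `≠ 2` containing an element `i` with `i² = −1`.
Let `A ∈ GLₙ(F)` and let `r ≥ n` be an integer such that `iʳ · det A = ±1`. Then
`A ⊕ (i Iᵣ) ∈ GL_{n+r}(F)` is a product of three involutions. -/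
theorem stmt7 {F : Type*} [Field F] (hchar : ringChar F ≠ 2)
    (i : F) (hi : i ^ 2 = -1)
    {n : ℕ} (A : Matrix (Fin n) (Fin n) F) (hA : IsUnit A)
    (r : ℕ) (hr : n ≤ r)
    (hdet : i ^ r * A.det = 1 ∨ i ^ r * A.det = -1) :
    ∃ S₁ S₂ S₃ : Matrix (Fin (n + r)) (Fin (n + r)) F,
      S₁ * S₁ = 1 ∧ S₂ * S₂ = 1 ∧ S₃ * S₃ = 1 ∧
      Matrix.reindex finSumFinEquiv finSumFinEquiv
        (Matrix.fromBlocks A 0 0 (i • (1 : Matrix (Fin r) (Fin r) F))) = S₁ * S₂ * S₃ := by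
  have h2 : (2 : F) ≠ 0 := Ring.two_ne_zero hchar
  set e : Fin n ⊕ Fin r ≃ Fin (n + r) := finSumFinEquiv
  set D := Matrix.fromBlocks A 0 0 (i • (1 : Matrix (Fin r) (Fin r) F))
  have hD : LinearMap.det (Matrix.toLin' (Matrix.reindex e e D)) ^ 2 = 1 := by
    rw [LinearMap.det_toLin', Matrix.det_reindex_self, Matrix.det_fromBlocks_zero₂₁,
      Matrix.det_smul, Matrix.det_one, mul_one, Fintype.card_fin, mul_comm]
    rcases hdet with h | h <;> simp [h]
  have hrank : 2 * Module.finrank F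
      (LinearMap.range (Matrix.toLin' (Matrix.reindex e e D) - i • 1)) ≤ n + r := by
    have h : Matrix.toLin' (Matrix.reindex e e D) - i • 1
        = Matrix.toLin' (Matrix.reindex e e (Matrix.fromBlocks (A - i • 1) 0 0 0)) := by
      have h1 : Matrix.reindex e e D = Matrix.reindex e e (Matrix.fromBlocks (A - i • 1) 0 0 0)
          + i • 1 := by
        rw [← Matrix.submatrix_one_equiv e.symm]
        change _ = Matrix.reindex e e (Matrix.fromBlocks (A - i • 1) 0 0 0 + i • 1)
        rw [← Matrix.fromBlocks_one, Matrix.fromBlocks_smul, Matrix.fromBlocks_add]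
        simp [D]
      rw [h1, map_add, map_smul, Matrix.toLin'_one]
      exact add_sub_cancel_right _ _
    have h3 := Matrix.rank_fromBlocks_zero_le (r := r) (A - i • 1)
    rw [← Matrix.rank_reindex e e] at h3
    rw [h]
    change 2 * Matrix.rank _ ≤ _
    omega
  obtain ⟨S₁, S₂, S₃, h₁, h₂, h₃, h⟩ := exists_three_involutions h2 hi _ hD hrank
  refine ⟨LinearMap.toMatrix' S₁, LinearMap.toMatrix' S₂, LinearMap.toMatrix' S₃, ?_, ?_, ?_, ?_⟩
  · rw [← LinearMap.toMatrix'_mul, h₁, LinearMap.toMatrix'_one]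
  · rw [← LinearMap.toMatrix'_mul, h₂, LinearMap.toMatrix'_one]
  · rw [← LinearMap.toMatrix'_mul, h₃, LinearMap.toMatrix'_one]
  · rw [← LinearMap.toMatrix'_mul, ← LinearMap.toMatrix'_mul, ← h, LinearMap.toMatrix'_toLin']
end
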